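/- arXiv:2506.02948 — 8 statements merged into one kernel-verified Lean document; each statement's English description precedes it below -/
import Mathlib

section
/- Let T > 0, β > 0, C₀ ≥ 0 and K ≥ 0 be real constants with βT^{4/5} ≤ 1 and β(C₀ + K) ≤ 1/2, and let A_≥ : [0,1] → ℝ be twice differentiable with |A_≥'(s)| ≤ KβT and |A_≥''(s)| ≤ KβT^{9/5} for all s ∈ [0,1]. Let 𝒯 be a ternary tree with branching-node set 𝒩 and node signs ζ, let (Ω_𝔫)_{𝔫∈𝒩} be real numbers, set Ω̃_𝔫(s) := Ω_𝔫(C₀βTs + A_≥(s)), and for each 𝔫 ∈ 𝒩 let f_𝔫 : [0,T] → ℂ be C¹ with sup_{0≤s≤1}|f_𝔫(Ts)| ≤ D_𝔫 and sup_{0≤s≤1}|(d/ds)f_𝔫(Ts)| ≤ D_𝔫 for constants D_𝔫 > 0. Define 𝒜^f recursively by 𝒜^f_•(s) = 1 for the trivial tree, and 𝒜^f_𝒯(s) = ∫₀^s e^{iζ_𝔯(Ω_𝔯 T s' + Ω̃_𝔯(s'))} f_𝔯(Ts') ∏_{j=1}^3 𝒜^f_{𝒯_j}(s') ds', where 𝔯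 is the root of 𝒯 and 𝒯₁,𝒯₂,𝒯₃ are its three children subtrees. Then there exists a constant C_d, depending only on C₀, K and the size of 𝒯 (and not on T, β, the Ω_𝔫 or the f_𝔫), such that for all s ∈ [0,1]: |𝒜^f_𝒯(s)| ≤ Σ_{(d_𝔫)∈{0,1}^𝒩} ∏_{𝔫∈𝒩} (C_d D_𝔫) ⟨T q_𝔫⟩^{−1}, where for each choice of (d_𝔫) the quantities q_𝔫 are defined recursively by q_𝔫 = 0 for leaves 𝔫, and q_𝔫 = d_{𝔫₁}q_{𝔫₁} − d_{𝔫₂}q_{𝔫₂} + d_{𝔫₃}q_{𝔫₃} + Ω_𝔫 when 𝔫 has children 𝔫₁,𝔫₂,𝔫₃. -/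
open MeasureTheory intervalIntegral Complex

/-- The data carried by each branching node of a ternary tree: a frequency `Ω`, a
function `f` with (a candidate for) its derivative `f'`, and a bound `D`. -/
structure NodeData where
  Ω : ℝ
  f : ℝ → ℂ
  f' : ℝ → ℂ
  D : ℝ

/-- A ternary tree: every branching node has exactly three ordered children and carries
a `NodeData`; leaves carry nothing. -/
inductive TernaryTree where
  | leaf : TernaryTree
  | node : NodeData → TernaryTree → TernaryTree → TernaryTree → TernaryTree

namespace TernaryTree

/-- The scale of a ternary tree: the number of branching nodes. -/
def size : TernaryTree → ℕ
  | leaf => 0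
  | node _ t1 t2 t3 => 1 + t1.size + t2.size + t3.size

/-- A predicate holds at every branching node of the tree. -/
def Forall (P : NodeData → Prop) : TernaryTree → Prop
  | leaf => True
  | node d t1 t2 t3 => P d ∧ t1.Forall P ∧ t2.Forall P ∧ t3.Forall P

/-- The oscillatory multi-integral `𝒜^f_𝒯(s)` of Proposition 3.1, defined recursively.
The parameter `ζ` is the sign of the root of the (sub)tree: the three children carry
signs `(ζ, -ζ, ζ)`.  The phase of the root node is
`ζ (Ω T s' + Ω̃(s'))` with `Ω̃(s') = Ω (C₀ β T s' + A(s'))`. -/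
noncomputable def Acal (T β C0 : ℝ) (A : ℝ → ℝ) : TernaryTree → ℝ → ℝ → ℂ
  | leaf, _, _ => 1
  | node d t1 t2 t3, ζ, s =>
      ∫ s' in (0 : ℝ)..s,
        Complex.exp (Complex.I * ζ * (d.Ω * (T * s') + d.Ω * (C0 * β * T * s' + A s')))
          * d.f (T * s')
          * (Acal T β C0 A t1 ζ s' * Acal T β C0 A t2 (-ζ) s' * Acal T β C0 A t3 ζ s')

/-- For every assignment `(d_𝔫) ∈ {0,1}^𝒩` of the branching nodes of the subtree, one
entry `(d_root * q_root, weight)`, where `q` is defined recursively by `q = 0` at leaves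
and `q_𝔫 = d_{𝔫₁} q_{𝔫₁} - d_{𝔫₂} q_{𝔫₂} + d_{𝔫₃} q_{𝔫₃} + Ω_𝔫` at branching nodes,
and the weight is `∏_{𝔫} Cd * D_𝔫 * ⟨T q_𝔫⟩⁻¹` over the branching nodes of the
subtree. -/
noncomputable def qList (T Cd : ℝ) : TernaryTree → List (ℝ × ℝ)
  | leaf => (0, 1) :: []
  | node dat t1 t2 t3 =>
      (qList T Cd t1).flatMap fun p1 =>
      (qList T Cd t2).flatMap fun p2 =>
      (qList T Cd t3).flatMap fun p3 =>
        let q : ℝ := p1.1 - p2.1 + p3.1 + dat.Ω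
        let w : ℝ := p1.2 * p2.2 * p3.2 * (Cd * dat.D * (Real.sqrt (1 + (T * q) ^ 2))⁻¹)
        (0, w) :: (q, w) :: []

/-- `Σ_{(d_𝔫) ∈ {0,1}^𝒩} ∏_{𝔫 ∈ 𝒩} (Cd * D_𝔫) ⟨T q_𝔫⟩⁻¹`. -/
noncomputable def boundSum (T Cd : ℝ) (t : TernaryTree) : ℝ :=
  ((qList T Cd t).map Prod.snd).sum

end TernaryTree

namespace IntegralEstimateAux

open Set

/-- A function on `[0,1]`, differentiable, bounded by `w` together with its derivative. -/
def Good (w : ℝ) (a : ℝ → ℂ) : Prop :=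
  ∃ a' : ℝ → ℂ, ∀ s ∈ Icc (0 : ℝ) 1,
    HasDerivWithinAt a (a' s) (Icc (0 : ℝ) 1) s ∧ ‖a s‖ ≤ w ∧ ‖a' s‖ ≤ w

lemma Good.nonneg {w : ℝ} {a : ℝ → ℂ} (h : Good w a) : 0 ≤ w := by
  obtain ⟨a', h⟩ := h
  exact (norm_nonneg _).trans (h 0 (by simp)).2.1

lemma Good.mono {w v : ℝ} {a : ℝ → ℂ} (h : Good w a) (hv : w ≤ v) : Good v a := by
  obtain ⟨a', h⟩ := h
  exact ⟨a', fun s hs => ⟨(h s hs).1, (h s hs).2.1.trans hv, (h s hs).2.2.trans hv⟩⟩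

lemma Good.continuousOn {w : ℝ} {a : ℝ → ℂ} (h : Good w a) :
    ContinuousOn a (Icc (0 : ℝ) 1) := by
  obtain ⟨a', h⟩ := h
  exact fun s hs => (h s hs).1.continuousWithinAt

lemma Good.mul {w v : ℝ} {a b : ℝ → ℂ} (ha : Good w a) (hb : Good v b) :
    Good (2 * w * v) (fun s => a s * b s) := by
  have hw := ha.nonneg
  have hv := hb.nonneg
  obtain ⟨a', ha⟩ := ha
  obtain ⟨b', hb⟩ := hb
  refine ⟨fun s => a' s * b s + a s * b' s, fun s hs => ?_⟩
  obtain ⟨h1, h2, h3⟩ := ha s hs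
  obtain ⟨k1, k2, k3⟩ := hb s hs
  refine ⟨h1.mul k1, ?_, ?_⟩
  · rw [norm_mul]
    have := mul_le_mul h2 k2 (norm_nonneg _) hw
    nlinarith [mul_nonneg hw hv]
  · refine (norm_add_le _ _).trans ?_
    rw [norm_mul, norm_mul]
    have := mul_le_mul h3 k2 (norm_nonneg _) hw
    have := mul_le_mul h2 k3 (norm_nonneg _) hw
    linarith

lemma Good.const_mul {w : ℝ} {a : ℝ → ℂ} (ha : Good w a) (c : ℂ) :
    Good (‖c‖ * w) (fun s => c * a s) := by
  obtain ⟨a', ha⟩ := ha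
  refine ⟨fun s => c * a' s, fun s hs => ?_⟩
  obtain ⟨h1, h2, h3⟩ := ha s hs
  refine ⟨h1.const_mul c, ?_, ?_⟩
  · rw [norm_mul]; gcongr
  · rw [norm_mul]; gcongr

lemma good_zero {w : ℝ} (hw : 0 ≤ w) : Good w (fun _ => 0) :=
  ⟨fun _ => 0, fun s _ => ⟨hasDerivWithinAt_const _ _ _, by simpa, by simpa⟩⟩

/-- The oscillating factor. -/
noncomputable def osc (φ : ℝ → ℝ) (x : ℝ) (s : ℝ) : ℂ :=
  Complex.exp (Complex.I * ((x * φ s : ℝ) : ℂ))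

lemma norm_osc (φ : ℝ → ℝ) (x s : ℝ) : ‖osc φ x s‖ = 1 := by
  unfold osc
  rw [mul_comm]
  exact Complex.norm_exp_ofReal_mul_I _

lemma osc_zero (φ : ℝ → ℝ) (s : ℝ) : osc φ 0 s = 1 := by simp [osc]

lemma osc_add (φ : ℝ → ℝ) (x y s : ℝ) : osc φ (x + y) s = osc φ x s * osc φ y s := by
  unfold osc
  rw [← Complex.exp_add]
  congr 1
  push_cast
  ring

lemma osc_deriv {φ φ' : ℝ → ℝ} {s : ℝ}
    (h : HasDerivWithinAt φ (φ' s) (Icc (0 : ℝ) 1) s) (x : ℝ) :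
    HasDerivWithinAt (osc φ x) (osc φ x s * (Complex.I * ((x * φ' s : ℝ) : ℂ)))
      (Icc (0 : ℝ) 1) s := by
  have h1 : HasDerivWithinAt (fun s => ((x * φ s : ℝ) : ℂ)) ((x * φ' s : ℝ) : ℂ)
      (Icc (0 : ℝ) 1) s := (h.const_mul x).ofReal_comp
  exact (h1.const_mul Complex.I).cexp

lemma osc_cont {φ : ℝ → ℝ} (h : ContinuousOn φ (Icc (0 : ℝ) 1)) (x : ℝ) :
    ContinuousOn (osc φ x) (Icc (0 : ℝ) 1) := by
  unfold osc
  fun_prop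

lemma intInt {H : ℝ → ℂ} (hH : ContinuousOn H (Icc (0 : ℝ) 1)) {s : ℝ}
    (hs : s ∈ Icc (0 : ℝ) 1) : IntervalIntegrable H volume 0 s := by
  apply ContinuousOn.intervalIntegrable
  apply hH.mono
  rw [uIcc_of_le hs.1]
  exact Icc_subset_Icc_right hs.2

lemma int_congr {H J : ℝ → ℂ} (h : EqOn H J (Icc (0 : ℝ) 1)) {s : ℝ}
    (hs : s ∈ Icc (0 : ℝ) 1) : ∫ x in (0 : ℝ)..s, H x = ∫ x in (0 : ℝ)..s, J x := by
  apply intervalIntegral.integral_congr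
  apply h.mono
  rw [uIcc_of_le hs.1]
  exact Icc_subset_Icc_right hs.2

lemma int_deriv {H : ℝ → ℂ} (hH : ContinuousOn H (Icc (0 : ℝ) 1)) {s : ℝ}
    (hs : s ∈ Icc (0 : ℝ) 1) :
    HasDerivWithinAt (fun s => ∫ x in (0 : ℝ)..s, H x) (H s) (Icc (0 : ℝ) 1) s := by
  have h01 : (0 : ℝ) ≤ 1 := zero_le_one
  have hc : Continuous (IccExtend h01 ((Icc (0 : ℝ) 1).domRestrict H)) :=
    (continuousOn_iff_continuous_domRestrict.1 hH).Icc_extend'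
  have he : EqOn H (IccExtend h01 ((Icc (0 : ℝ) 1).domRestrict H)) (Icc (0 : ℝ) 1) := by
    intro x hx
    rw [IccExtend_of_mem _ _ hx]
    rfl
  have h1 := (hc.integral_hasStrictDerivAt 0 s).hasDerivAt.hasDerivWithinAt
    (s := Icc (0 : ℝ) 1)
  rw [← he hs] at h1
  exact h1.congr (fun x hx => int_congr he hx) (int_congr he hs)

/-- `g` is a sum of oscillating terms indexed by the list. -/
def Rep (φ : ℝ → ℝ) (ζ : ℝ) : List (ℝ × ℝ) → (ℝ → ℂ) → Prop
  | [], g => ∀ s ∈ Icc (0 : ℝ) 1, g s = 0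
  | p :: L, g => ∃ a b : ℝ → ℂ, Good p.2 a ∧ Rep φ ζ L b ∧
      ∀ s ∈ Icc (0 : ℝ) 1, g s = osc φ (ζ * p.1) s * a s + b s

lemma Rep.congr {φ : ℝ → ℝ} {ζ : ℝ} {L : List (ℝ × ℝ)} {g h : ℝ → ℂ}
    (hg : Rep φ ζ L g) (e : EqOn h g (Icc (0 : ℝ) 1)) : Rep φ ζ L h := by
  cases L with
  | nil => exact fun s hs => (e hs).trans (hg s hs)
  | cons p L =>
    obtain ⟨a, b, h1, h2, h3⟩ := hg
    exact ⟨a, b, h1, h2, fun s hs => (e hs).trans (h3 s hs)⟩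

lemma Rep.continuousOn {φ : ℝ → ℝ} (hφ : ContinuousOn φ (Icc (0 : ℝ) 1)) {ζ : ℝ}
    {L : List (ℝ × ℝ)} {g : ℝ → ℂ} (hg : Rep φ ζ L g) : ContinuousOn g (Icc (0 : ℝ) 1) := by
  induction L generalizing g with
  | nil => exact continuousOn_const.congr hg
  | cons p L ih =>
    obtain ⟨a, b, h1, h2, h3⟩ := hg
    exact (((osc_cont hφ _).mul h1.continuousOn).add (ih h2)).congr h3

lemma Rep.bound {φ : ℝ → ℝ} {ζ : ℝ} {L : List (ℝ × ℝ)} {g : ℝ → ℂ} (hg : Rep φ ζ L g)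
    {s : ℝ} (hs : s ∈ Icc (0 : ℝ) 1) : ‖g s‖ ≤ (L.map Prod.snd).sum := by
  induction L generalizing g with
  | nil => simp [hg s hs]
  | cons p L ih =>
    obtain ⟨a, b, ⟨a', h1⟩, h2, h3⟩ := hg
    rw [h3 s hs, List.map_cons, List.sum_cons]
    refine (norm_add_le _ _).trans (add_le_add ?_ (ih h2))
    rw [norm_mul, norm_osc, one_mul]
    exact (h1 s hs).2.1

lemma Rep.append {φ : ℝ → ℝ} {ζ : ℝ} {L M : List (ℝ × ℝ)} {g h : ℝ → ℂ}
    (hg : Rep φ ζ L g) (hh : Rep φ ζ M h) : Rep φ ζ (L ++ M) (fun s => g s + h s) := by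
  induction L generalizing g with
  | nil => exact hh.congr fun s hs => by simp [hg s hs]
  | cons p L ih =>
    obtain ⟨a, b, h1, h2, h3⟩ := hg
    exact ⟨a, _, h1, ih h2, fun s hs => by simp only [h3 s hs]; ring⟩

lemma Rep.flatMap {φ : ℝ → ℝ} (hφ : ContinuousOn φ (Icc (0 : ℝ) 1)) {ζ ζ' : ℝ}
    {L : List (ℝ × ℝ)} {g H : ℝ → ℂ} (hg : Rep φ ζ' L g)
    (hH : ContinuousOn H (Icc (0 : ℝ) 1)) (k : ℝ × ℝ → List (ℝ × ℝ))
    (hk : ∀ p a, Good p.2 a →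
      Rep φ ζ (k p) (fun s => ∫ x in (0 : ℝ)..s, H x * (osc φ (ζ' * p.1) x * a x))) :
    Rep φ ζ (L.flatMap k) (fun s => ∫ x in (0 : ℝ)..s, H x * g x) := by
  induction L generalizing g with
  | nil =>
    intro s hs
    have := int_congr (H := fun x => H x * g x) (J := fun _ => 0)
      (fun x hx => by simp [show g x = 0 from hg x hx]) hs
    simpa using this
  | cons p L ih =>
    obtain ⟨a, b, h1, h2, h3⟩ := hg
    rw [List.flatMap_cons]
    refine ((hk p a h1).append (ih h2)).congr fun s hs => ?_
    simp only
    have i1 : IntervalIntegrable (fun x => H x * (osc φ (ζ' * p.1) x * a x)) volume 0 s :=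
      intInt (hH.mul ((osc_cont hφ _).mul h1.continuousOn)) hs
    have i2 : IntervalIntegrable (fun x => H x * b x) volume 0 s :=
      intInt (hH.mul (h2.continuousOn hφ)) hs
    rw [← intervalIntegral.integral_add i1 i2]
    exact int_congr (fun x hx => by simp only [h3 x hx]; ring) hs

lemma step {φ φ' φ'' : ℝ → ℝ} {T K : ℝ} (hT : 0 < T) (hK : 0 ≤ K)
    (h1 : ∀ s ∈ Icc (0 : ℝ) 1, HasDerivWithinAt φ (φ' s) (Icc (0 : ℝ) 1) s)
    (h2 : ∀ s ∈ Icc (0 : ℝ) 1, HasDerivWithinAt φ' (φ'' s) (Icc (0 : ℝ) 1) s)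
    (h3 : ∀ s ∈ Icc (0 : ℝ) 1, T / 2 ≤ φ' s)
    (h4 : ∀ s ∈ Icc (0 : ℝ) 1, |φ'' s| ≤ K * T)
    {ζ q M : ℝ} (hζ : |ζ| = 1) {F : ℝ → ℂ} (hF : Good M F) :
    ∃ a0 a1 : ℝ → ℂ, Good (M * ((16 + 32 * K) * (Real.sqrt (1 + (T * q) ^ 2))⁻¹)) a0 ∧
      Good (M * ((16 + 32 * K) * (Real.sqrt (1 + (T * q) ^ 2))⁻¹)) a1 ∧
      ∀ s ∈ Icc (0 : ℝ) 1, ∫ x in (0 : ℝ)..s, osc φ (ζ * q) x * F x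
        = a0 s + osc φ (ζ * q) s * a1 s := by
  have hM := hF.nonneg
  have hφ : ContinuousOn φ (Icc (0 : ℝ) 1) := fun s hs => (h1 s hs).continuousWithinAt
  have hcont : ContinuousOn (fun s => osc φ (ζ * q) s * F s) (Icc (0 : ℝ) 1) :=
    (osc_cont hφ (ζ * q)).mul hF.continuousOn
  have hd := fun s hs => int_deriv hcont (s := s) hs
  set R := Real.sqrt (1 + (T * q) ^ 2) with hR
  have hR0 : 0 < R := Real.sqrt_pos.2 (by positivity)
  have mvt : ∀ (g g' : ℝ → ℂ) (B : ℝ),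
      (∀ s ∈ Icc (0 : ℝ) 1, HasDerivWithinAt g (g' s) (Icc (0 : ℝ) 1) s) →
      (∀ s ∈ Icc (0 : ℝ) 1, ‖g' s‖ ≤ B) → ∀ s ∈ Icc (0 : ℝ) 1, ‖g s‖ ≤ ‖g 0‖ + B := by
    intro g g' B hg hb s hs
    have := Convex.norm_image_sub_le_of_norm_hasDerivWithin_le hg hb
      (convex_Icc (0 : ℝ) 1) (left_mem_Icc.2 zero_le_one) hs
    have hB : 0 ≤ B := (norm_nonneg _).trans (hb s hs)
    rw [sub_zero, Real.norm_eq_abs, abs_of_nonneg hs.1] at this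
    have h' : ‖g s‖ ≤ ‖g 0‖ + ‖g s - g 0‖ := by
      simpa using norm_add_le (g 0) (g s - g 0)
    nlinarith [hs.2]
  by_cases hq : |T * q| < 1
  · have hR2 : R ≤ 2 := by
      rw [hR, Real.sqrt_le_left (by norm_num)]
      have := (sq_lt_one_iff_abs_lt_one _).2 hq
      linarith
    have hW : M ≤ M * ((16 + 32 * K) * R⁻¹) := by
      apply le_mul_of_one_le_right hM
      rw [← div_eq_mul_inv, le_div_iff₀ hR0]
      linarith
    refine ⟨fun s => ∫ x in (0 : ℝ)..s, osc φ (ζ * q) x * F x, fun _ => 0, ?_,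
      good_zero (hM.trans hW), fun s hs => by simp⟩
    have hb : ∀ s ∈ Icc (0 : ℝ) 1, ‖osc φ (ζ * q) s * F s‖ ≤ M := by
      intro s hs
      obtain ⟨F', hF⟩ := hF
      rw [norm_mul, norm_osc, one_mul]
      exact (hF s hs).2.1
    refine Good.mono ⟨_, fun s hs => ⟨hd s hs, ?_, hb s hs⟩⟩ hW
    simpa using mvt _ _ M hd hb s hs
  · push Not at hq
    have hR2 : R ≤ 2 * |T * q| := by
      rw [hR, Real.sqrt_le_left (by positivity), mul_pow 2, sq_abs]
      have : 1 ≤ (T * q) ^ 2 := by rw [← sq_abs]; nlinarith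
      linarith
    have hTq : 0 < |T * q| := by linarith
    have hq0 : q ≠ 0 := by
      rintro rfl
      simp at hTq
    have hζ0 : ζ ≠ 0 := by
      rintro rfl
      simp at hζ
    -- the function `T / φ'`
    have hh : Good (2 + 4 * K) (fun s => ((T * (φ' s)⁻¹ : ℝ) : ℂ)) := by
      refine ⟨fun s => ((T * (-φ'' s / φ' s ^ 2) : ℝ) : ℂ), fun s hs => ?_⟩
      have hp : 0 < φ' s := by linarith [h3 s hs]
      refine ⟨(((h2 s hs).inv hp.ne').const_mul T).ofReal_comp, ?_, ?_⟩
      · rw [Complex.norm_real, Real.norm_eq_abs, abs_of_pos (by positivity),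
          ← div_eq_mul_inv, div_le_iff₀ hp]
        nlinarith [h3 s hs, mul_nonneg hK hp.le]
      · rw [Complex.norm_real, Real.norm_eq_abs, abs_mul, abs_div, abs_neg, abs_of_pos hT,
          abs_of_pos (pow_pos hp 2), ← mul_div_assoc, div_le_iff₀ (pow_pos hp 2)]
        have e1 : T * |φ'' s| ≤ T * (K * T) := by gcongr; exact h4 s hs
        have e2 : (T / 2) ^ 2 ≤ φ' s ^ 2 := by gcongr; exact h3 s hs
        nlinarith [mul_le_mul_of_nonneg_left e2 hK, pow_pos hp 2]
    have hc : ‖(1 / (Complex.I * ((ζ * (T * q) : ℝ) : ℂ)))‖ = 1 / |T * q| := by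
      rw [norm_div, norm_mul, Complex.norm_I, Complex.norm_real, Real.norm_eq_abs, abs_mul,
        hζ]
      simp
    have ha := (hF.mul hh).const_mul (1 / (Complex.I * ((ζ * (T * q) : ℝ) : ℂ)))
    rw [hc] at ha
    set a1 : ℝ → ℂ := fun s => 1 / (Complex.I * ((ζ * (T * q) : ℝ) : ℂ)) *
      (F s * ((T * (φ' s)⁻¹ : ℝ) : ℂ)) with ha1
    set B := 1 / |T * q| * (2 * M * (2 + 4 * K)) with hB
    have hB0 : 0 ≤ B := by positivity
    have hBW : 2 * B ≤ M * ((16 + 32 * K) * R⁻¹) := by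
      have : 1 / |T * q| ≤ 2 * R⁻¹ := by
        rw [← div_eq_mul_inv, div_le_div_iff₀ hTq hR0]
        linarith
      calc 2 * B = 1 / |T * q| * (M * (8 + 16 * K)) := by rw [hB]; ring
        _ ≤ 2 * R⁻¹ * (M * (8 + 16 * K)) := by gcongr
        _ = _ := by ring
    refine ⟨fun s => (∫ x in (0 : ℝ)..s, osc φ (ζ * q) x * F x) - osc φ (ζ * q) s * a1 s, a1,
      ?_, ha.mono (by linarith), fun s hs => by ring⟩
    obtain ⟨a1', ha'⟩ := ha
    have key : ∀ s ∈ Icc (0 : ℝ) 1, HasDerivWithinAt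
        (fun s => (∫ x in (0 : ℝ)..s, osc φ (ζ * q) x * F x) - osc φ (ζ * q) s * a1 s)
        (-(osc φ (ζ * q) s * a1' s)) (Icc (0 : ℝ) 1) s := by
      intro s hs
      have hp : 0 < φ' s := by linarith [h3 s hs]
      refine ((hd s hs).sub ((osc_deriv (h1 s hs) (ζ * q)).mul (ha' s hs).1)).congr_deriv ?_
      have : (Complex.I * ((ζ * q * φ' s : ℝ) : ℂ)) * a1 s = F s := by
        have t1 : (T : ℂ) ≠ 0 := by exact_mod_cast hT.ne'
        have t2 : (q : ℂ) ≠ 0 := by exact_mod_cast hq0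
        have t3 : (ζ : ℂ) ≠ 0 := by exact_mod_cast hζ0
        have t4 : (φ' s : ℂ) ≠ 0 := by exact_mod_cast hp.ne'
        have t5 := Complex.I_ne_zero
        rw [ha1]
        push_cast
        field_simp
      linear_combination (-osc φ (ζ * q) s) * this
    have hb : ∀ s ∈ Icc (0 : ℝ) 1, ‖-(osc φ (ζ * q) s * a1' s)‖ ≤ B := by
      intro s hs
      rw [norm_neg, norm_mul, norm_osc, one_mul]
      exact (ha' s hs).2.2
    refine Good.mono ⟨_, fun s hs => ⟨key s hs, ?_, (hb s hs).trans (by linarith)⟩⟩ hBW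
    refine (mvt _ _ B key hb s hs).trans ?_
    have h0 := (ha' 0 (by simp)).2.1
    simp only [intervalIntegral.integral_same, zero_sub, norm_neg, norm_mul, norm_osc, one_mul]
    linarith

lemma comp_good {T D : ℝ} (hT : 0 < T) {f f' : ℝ → ℂ}
    (h1 : ∀ x ∈ Icc (0 : ℝ) T, HasDerivWithinAt f (f' x) (Icc (0 : ℝ) T) x)
    (h2 : ∀ s ∈ Icc (0 : ℝ) 1, ‖f (T * s)‖ ≤ D)
    (h3 : ∀ s ∈ Icc (0 : ℝ) 1, ‖(T : ℂ) * f' (T * s)‖ ≤ D) :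
    Good D (fun s => f (T * s)) := by
  refine ⟨fun s => (T : ℂ) * f' (T * s), fun s hs => ⟨?_, h2 s hs, h3 s hs⟩⟩
  have hm : MapsTo (fun s : ℝ => T * s) (Icc (0 : ℝ) 1) (Icc (0 : ℝ) T) := fun x hx =>
    ⟨mul_nonneg hT.le hx.1, by nlinarith [hx.2]⟩
  have hl : HasDerivWithinAt (fun s : ℝ => T * s) T (Icc (0 : ℝ) 1) s := by
    simpa using (hasDerivWithinAt_id s (Icc (0 : ℝ) 1)).const_mul T
  have := (h1 (T * s) (hm hs)).scomp s hl hm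
  simpa [Function.comp_def] using this

lemma rep_tree {T β C0 K : ℝ} {A φ φ' φ'' : ℝ → ℝ} (hT : 0 < T) (hK : 0 ≤ K)
    (hφ : ∀ s, φ s = T * s + (C0 * β * T * s + A s))
    (h1 : ∀ s ∈ Icc (0 : ℝ) 1, HasDerivWithinAt φ (φ' s) (Icc (0 : ℝ) 1) s)
    (h2 : ∀ s ∈ Icc (0 : ℝ) 1, HasDerivWithinAt φ' (φ'' s) (Icc (0 : ℝ) 1) s)
    (h3 : ∀ s ∈ Icc (0 : ℝ) 1, T / 2 ≤ φ' s)
    (h4 : ∀ s ∈ Icc (0 : ℝ) 1, |φ'' s| ≤ K * T) (t : TernaryTree)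
    (ht : t.Forall (fun d => 0 < d.D ∧
          (∀ x ∈ Set.Icc (0 : ℝ) T, HasDerivWithinAt d.f (d.f' x) (Set.Icc (0 : ℝ) T) x) ∧
          (∀ s ∈ Set.Icc (0 : ℝ) 1, ‖d.f (T * s)‖ ≤ d.D) ∧
          (∀ s ∈ Set.Icc (0 : ℝ) 1, ‖(T : ℂ) * d.f' (T * s)‖ ≤ d.D)))
    (ζ : ℝ) (hζ : |ζ| = 1) :
    Rep φ ζ (TernaryTree.qList T (128 + 256 * K) t) (TernaryTree.Acal T β C0 A t ζ) := by
  have hc : ContinuousOn φ (Icc (0 : ℝ) 1) := fun s hs => (h1 s hs).continuousWithinAt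
  induction t generalizing ζ with
  | leaf =>
    refine ⟨fun _ => 1, fun _ => 0, ⟨fun _ => 0, fun s _ =>
      ⟨hasDerivWithinAt_const _ _ _, by simp, by simp⟩⟩, fun s hs => rfl, fun s hs => ?_⟩
    simp [TernaryTree.Acal, osc_zero]
  | node d t1 t2 t3 ih1 ih2 ih3 =>
    obtain ⟨⟨hD, hf1, hf2, hf3⟩, ht1, ht2, ht3⟩ := ht
    have hf := comp_good hT hf1 hf2 hf3
    have r1 := ih1 ht1 ζ hζ
    have r2 := ih2 ht2 (-ζ) (by rwa [abs_neg])
    have r3 := ih3 ht3 ζ hζ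
    have c1 := r1.continuousOn hc
    have c2 := r2.continuousOn hc
    have c3 := r3.continuousOn hc
    have cE := (osc_cont hc (ζ * d.Ω)).mul hf.continuousOn
    have hrep := r1.flatMap (ζ := ζ) hc (H := fun s => (osc φ (ζ * d.Ω) s * d.f (T * s)) *
        (TernaryTree.Acal T β C0 A t2 (-ζ) s * TernaryTree.Acal T β C0 A t3 ζ s))
      (cE.mul (c2.mul c3))
      (fun p1 => (TernaryTree.qList T (128 + 256 * K) t2).flatMap fun p2 =>
        (TernaryTree.qList T (128 + 256 * K) t3).flatMap fun p3 =>
        let q : ℝ := p1.1 - p2.1 + p3.1 + d.Ω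
        let w : ℝ := p1.2 * p2.2 * p3.2 *
          ((128 + 256 * K) * d.D * (Real.sqrt (1 + (T * q) ^ 2))⁻¹)
        (0, w) :: (q, w) :: []) ?_
    · refine Rep.congr hrep fun s hs => ?_
      simp only [TernaryTree.Acal]
      refine int_congr (fun x hx => ?_) hs
      have : Complex.exp (Complex.I * ζ * (d.Ω * (T * x) + d.Ω * (C0 * β * T * x + A x)))
          = osc φ (ζ * d.Ω) x := by
        unfold osc
        rw [hφ]
        congr 1
        push_cast
        ring
      simp only [this]
      ring
    intro p1 a1 g1
    have k1 := (osc_cont hc (ζ * p1.1)).mul g1.continuousOn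
    refine (r2.flatMap (ζ := ζ) hc (H := fun s => (osc φ (ζ * d.Ω) s * d.f (T * s)) *
        ((osc φ (ζ * p1.1) s * a1 s) * TernaryTree.Acal T β C0 A t3 ζ s))
        (cE.mul (k1.mul c3)) _ ?_).congr
        (fun s hs => int_congr (fun x hx => by ring) hs)
    intro p2 a2 g2
    have k2 := (osc_cont hc (-ζ * p2.1)).mul g2.continuousOn
    refine (r3.flatMap (ζ := ζ) hc (H := fun s => (osc φ (ζ * d.Ω) s * d.f (T * s)) *
        ((osc φ (ζ * p1.1) s * a1 s) * (osc φ (-ζ * p2.1) s * a2 s)))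
        (cE.mul (k1.mul k2)) _ ?_).congr
        (fun s hs => int_congr (fun x hx => by ring) hs)
    intro p3 a3 g3
    obtain ⟨b0, b1, e0, e1, e2⟩ := step hT hK h1 h2 h3 h4 (ζ := ζ)
      (q := p1.1 - p2.1 + p3.1 + d.Ω) hζ (((hf.mul g1).mul g2).mul g3)
    have hW : 2 * (2 * (2 * d.D * p1.2) * p2.2) * p3.2 * ((16 + 32 * K) *
        (Real.sqrt (1 + (T * (p1.1 - p2.1 + p3.1 + d.Ω)) ^ 2))⁻¹) =
        p1.2 * p2.2 * p3.2 * ((128 + 256 * K) * d.D *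
        (Real.sqrt (1 + (T * (p1.1 - p2.1 + p3.1 + d.Ω)) ^ 2))⁻¹) := by ring
    rw [hW] at e0 e1
    refine ⟨b0, fun s => osc φ (ζ * (p1.1 - p2.1 + p3.1 + d.Ω)) s * b1 s, e0,
      ⟨b1, fun _ => 0, e1, fun s hs => rfl, fun s hs => by simp⟩, fun s hs => ?_⟩
    simp only [mul_zero, osc_zero, one_mul]
    rw [← e2 s hs]
    refine int_congr (fun x hx => ?_) hs
    have : ζ * (p1.1 - p2.1 + p3.1 + d.Ω) = ζ * p1.1 + -ζ * p2.1 + ζ * p3.1 + ζ * d.Ω := by ring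
    simp only [this, osc_add]
    ring

end IntegralEstimateAux

/-- **Proposition 3.1 (integral estimate with unconserved nonlinear frequency shift).**
There is a constant `Cd`, depending only on `C₀`, `K` and the size of the ternary tree,
such that the oscillatory multi-integral `𝒜^f_𝒯(s)` is bounded by
`Σ_{(d_𝔫) ∈ {0,1}^𝒩} ∏_{𝔫 ∈ 𝒩} (Cd * D_𝔫) ⟨T q_𝔫⟩⁻¹` for all `s ∈ [0,1]`, provided
`β T^{4/5} ≤ 1`, `β (C₀ + K) ≤ 1/2`, `|A_≥'| ≤ K β T`, `|A_≥''| ≤ K β T^{9/5}`, and each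
node function `f_𝔫` is `C¹` on `[0,T]` with `|f_𝔫(Ts)| ≤ D_𝔫` and
`|(d/ds) f_𝔫(Ts)| ≤ D_𝔫` for `s ∈ [0,1]`. -/
theorem integral_estimate (C0 K : ℝ) (hC0 : 0 ≤ C0) (hK : 0 ≤ K) (n : ℕ) :
    ∃ Cd : ℝ, 0 < Cd ∧
      ∀ (T β : ℝ), 0 < T → 0 < β → β * T ^ ((4 : ℝ) / 5) ≤ 1 → β * (C0 + K) ≤ 1 / 2 →
      ∀ (A A' A'' : ℝ → ℝ),
        (∀ s ∈ Set.Icc (0 : ℝ) 1, HasDerivWithinAt A (A' s) (Set.Icc (0 : ℝ) 1) s) →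
        (∀ s ∈ Set.Icc (0 : ℝ) 1, HasDerivWithinAt A' (A'' s) (Set.Icc (0 : ℝ) 1) s) →
        (∀ s ∈ Set.Icc (0 : ℝ) 1, |A' s| ≤ K * β * T) →
        (∀ s ∈ Set.Icc (0 : ℝ) 1, |A'' s| ≤ K * β * T ^ ((9 : ℝ) / 5)) →
      ∀ t : TernaryTree, t.size = n →
        t.Forall (fun d => 0 < d.D ∧
          (∀ x ∈ Set.Icc (0 : ℝ) T, HasDerivWithinAt d.f (d.f' x) (Set.Icc (0 : ℝ) T) x) ∧
          (∀ s ∈ Set.Icc (0 : ℝ) 1, ‖d.f (T * s)‖ ≤ d.D) ∧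
          (∀ s ∈ Set.Icc (0 : ℝ) 1, ‖(T : ℂ) * d.f' (T * s)‖ ≤ d.D)) →
      ∀ s ∈ Set.Icc (0 : ℝ) 1,
        ‖TernaryTree.Acal T β C0 A t 1 s‖ ≤ TernaryTree.boundSum T Cd t := by
  refine ⟨128 + 256 * K, by positivity, ?_⟩
  intro T β hT hβ hβT hβK A A' A'' hA hA' hA1 hA2 t _ ht s hs
  have hβK' : β * K ≤ 1 / 2 := by nlinarith [mul_nonneg hβ.le hC0]
  refine (IntegralEstimateAux.rep_tree (φ := fun s => T * s + (C0 * β * T * s + A s))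
    (φ' := fun s => T + (C0 * β * T + A' s)) (φ'' := A'') (β := β) (C0 := C0) (A := A)
    hT hK (fun _ => rfl) ?_ ?_ ?_ ?_ t ht 1 (by simp)).bound hs
  · intro x hx
    have e1 := (hasDerivWithinAt_id x (Set.Icc (0 : ℝ) 1)).const_mul T
    have e2 := (hasDerivWithinAt_id x (Set.Icc (0 : ℝ) 1)).const_mul (C0 * β * T)
    refine (e1.add (e2.add (hA x hx))).congr_deriv ?_
    simp
  · intro x hx
    simpa using ((hA' x hx).const_add (C0 * β * T)).const_add T
  · intro x hx
    have e1 := (abs_le.1 (hA1 x hx)).1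
    have e2 : 0 ≤ C0 * β * T := by positivity
    have e3 := mul_le_mul_of_nonneg_right hβK' hT.le
    linarith
  · intro x hx
    refine (hA2 x hx).trans ?_
    have e : T ^ ((9 : ℝ) / 5) = T ^ ((4 : ℝ) / 5) * T := by
      rw [← Real.rpow_add_one hT.ne']
      norm_num
    rw [e]
    have := mul_le_mul_of_nonneg_left hβT (mul_nonneg hK hT.le)
    linarith
end

section
/- Fix ε ∈ (0,1). There is a constant C = C(ε) such that for every integer N ≥ 2, every real T with 1 < T ≤ N^{1−ε}, every k ∈ ℤ_N ∩ (−1,2), and every m ∈ ℝ, the set S₂⁺ = {(x,y) ∈ ℤ_N² ∩ (0,1)² : x + y = k and |sin(πx) + sin(πy) − m| ≤ T^{−1}} satisfies Σ_{(x,y)∈S₂⁺} |sin(πx) sin(π(k−x))| ≤ C N T^{−1/2}. -/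
open Real

/-- A finite set of integers with pairwise differences at most `L` has at most `L+1` elements. -/
lemma card_le_of_diff (P : Finset ℤ) (L : ℝ) (hL : 0 ≤ L)
    (h : ∀ a ∈ P, ∀ b ∈ P, (a : ℝ) - b ≤ L) : (P.card : ℝ) ≤ L + 1 := by
  rcases P.eq_empty_or_nonempty with rfl | hne
  · simp; linarith
  · have hsub : P ⊆ Finset.Icc (P.min' hne) (P.max' hne) := fun x hx =>
      Finset.mem_Icc.2 ⟨P.min'_le x hx, P.le_max' x hx⟩
    have hc := Finset.card_le_card hsub
    rw [Int.card_Icc] at hc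
    have hmm : P.min' hne ≤ P.max' hne := P.min'_le _ (P.max'_mem hne)
    have h1 : (P.card : ℤ) ≤ P.max' hne + 1 - P.min' hne := by omega
    have h2 : (P.card : ℝ) ≤ (P.max' hne : ℝ) + 1 - (P.min' hne : ℝ) := by exact_mod_cast h1
    have h3 := h _ (P.max'_mem hne) _ (P.min'_mem hne)
    linarith

lemma sin_pi_ge (t : ℝ) (h0 : 0 ≤ t) (h1 : t ≤ 1 / 2) : 2 * t ≤ sin (π * t) := by
  have := Real.mul_le_sin (x := π * t) (by positivity) (by nlinarith [pi_pos])
  have e : 2 / π * (π * t) = 2 * t := by field_simp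
  linarith

lemma cos_gap_aux (u v : ℝ) (hv : 0 ≤ v) (hvu : v ≤ u) (hu : u ≤ 1 / 2) :
    2 * (u - v) ^ 2 ≤ cos (π * v) - cos (π * u) := by
  have e : cos (π * v) - cos (π * u) = 2 * sin (π * ((u + v) / 2)) * sin (π * ((u - v) / 2)) := by
    rw [Real.cos_sub_cos]
    have : (π * v - π * u) / 2 = -(π * ((u - v) / 2)) := by ring
    rw [this, sin_neg]
    have : (π * v + π * u) / 2 = π * ((u + v) / 2) := by ring
    rw [this]; ring
  have h1 := sin_pi_ge ((u + v) / 2) (by linarith) (by linarith)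
  have h2 := sin_pi_ge ((u - v) / 2) (by linarith) (by linarith)
  rw [e]
  have h3 : (u - v) * (u - v) ≤ sin (π * ((u + v) / 2)) * sin (π * ((u - v) / 2)) :=
    mul_le_mul (by linarith) (by linarith) (by linarith) (by linarith)
  nlinarith

lemma cos_gap (u v : ℝ) (hu0 : 0 ≤ u) (hv0 : 0 ≤ v) (hu : u ≤ 1 / 2) (hv : v ≤ 1 / 2) :
    2 * (u - v) ^ 2 ≤ |cos (π * u) - cos (π * v)| := by
  rcases le_total v u with h | h
  · have := cos_gap_aux u v hv0 h hu
    rw [abs_sub_comm]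
    exact this.trans (le_abs_self _)
  · have := cos_gap_aux v u hu0 h hv
    have e : (u - v) ^ 2 = (v - u) ^ 2 := by ring
    rw [e]
    exact this.trans (le_abs_self _)

lemma sum_formula (k x : ℝ) : sin (π * x) + sin (π * (k - x)) =
    2 * sin (π * (k / 2)) * cos (π * (x - k / 2)) := by
  have e1 : π * x = π * (k / 2) + π * (x - k / 2) := by ring
  have e2 : π * (k - x) = π * (k / 2) - π * (x - k / 2) := by ring
  rw [e1, e2, sin_add, sin_sub]; ring

lemma prod_le (k x : ℝ) : sin (π * x) * sin (π * (k - x)) ≤ sin (π * (k / 2)) ^ 2 := by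
  have e1 : π * x = π * (k / 2) + π * (x - k / 2) := by ring
  have e2 : π * (k - x) = π * (k / 2) - π * (x - k / 2) := by ring
  rw [e1, e2, sin_add, sin_sub]
  nlinarith [sq_nonneg (sin (π * (x - k / 2))), sin_sq_add_cos_sq (π * (k / 2)),
    sin_sq_add_cos_sq (π * (x - k / 2))]

/-- The diameter bound for points on one side of `k/2`. -/
lemma diff_bound (k x x' m T σ : ℝ) (hT : 0 < T) (hs : 0 < sin (π * (k / 2)))
    (hσ : σ = 1 ∨ σ = -1)
    (hx0 : 0 ≤ σ * (x - k / 2)) (hx1 : σ * (x - k / 2) ≤ 1 / 2)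
    (hy0 : 0 ≤ σ * (x' - k / 2)) (hy1 : σ * (x' - k / 2) ≤ 1 / 2)
    (hx : |sin (π * x) + sin (π * (k - x)) - m| ≤ T⁻¹)
    (hy : |sin (π * x') + sin (π * (k - x')) - m| ≤ T⁻¹) :
    x - x' ≤ √((sin (π * (k / 2)) * T)⁻¹) := by
  rw [sum_formula] at hx hy
  set s := sin (π * (k / 2))
  have hc : ∀ z, cos (π * z) = cos (π * (σ * z)) := by
    intro z
    rcases hσ with rfl | rfl
    · simp
    · rw [show π * (-1 * z) = -(π * z) by ring, cos_neg]
  rw [hc] at hx hy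
  have hg := cos_gap _ _ hx0 hy0 hx1 hy1
  set c := cos (π * (σ * (x - k / 2)))
  set d := cos (π * (σ * (x' - k / 2)))
  have e : (σ * (x - k / 2) - σ * (x' - k / 2)) ^ 2 = (x - x') ^ 2 := by
    rcases hσ with rfl | rfl <;> ring
  rw [e] at hg
  have h1 : 2 * s * |c - d| ≤ 2 * T⁻¹ := by
    have : 2 * s * |c - d| = |2 * s * c - 2 * s * d| := by
      rw [← mul_sub, abs_mul, abs_of_pos (by positivity : 0 < 2 * s)]
    rw [this, abs_le]
    rw [abs_le] at hx hy
    constructor <;> linarith [hx.1, hx.2, hy.1, hy.2]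
  apply Real.le_sqrt_of_sq_le
  have h2 : s * (x - x') ^ 2 ≤ T⁻¹ := by
    have := mul_le_mul_of_nonneg_left hg hs.le
    nlinarith [mul_nonneg hs.le (sq_nonneg (x - x'))]
  rw [mul_inv, ← div_eq_inv_mul, le_div_iff₀ hs]
  linarith

lemma count_bound (S : Finset ℤ) (N : ℕ) (hN : 0 < N) (k m T : ℝ) (hT : 0 < T)
    (hs : 0 < sin (π * (k / 2)))
    (hS : ∀ a ∈ S, |(a : ℝ) / N - k / 2| ≤ 1 / 2 ∧
      |sin (π * ((a : ℝ) / N)) + sin (π * (k - (a : ℝ) / N)) - m| ≤ T⁻¹) :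
    (S.card : ℝ) ≤ 2 * (N * √((sin (π * (k / 2)) * T)⁻¹) + 1) := by
  have hN' : (0 : ℝ) < N := by exact_mod_cast hN
  have key : ∀ a b : ℤ, (a : ℝ) / N - (b : ℝ) / N ≤ √((sin (π * (k / 2)) * T)⁻¹) →
      (a : ℝ) - b ≤ N * √((sin (π * (k / 2)) * T)⁻¹) := by
    intro a b h
    rw [← sub_div, div_le_iff₀ hN'] at h
    linarith
  have h1 : ((S.filter (fun a : ℤ => 0 ≤ (a : ℝ) / N - k / 2)).card : ℝ) ≤
      N * √((sin (π * (k / 2)) * T)⁻¹) + 1 := by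
    apply card_le_of_diff _ _ (by positivity)
    intro a ha b hb
    rw [Finset.mem_filter] at ha hb
    have hA := hS a ha.1
    have hB := hS b hb.1
    apply key
    rw [abs_le] at hA hB
    exact diff_bound k _ _ m T 1 hT hs (Or.inl rfl) (by linarith) (by linarith [hA.1.2])
      (by linarith) (by linarith [hB.1.2]) hA.2 hB.2
  have h2 : ((S.filter (fun a : ℤ => ¬ 0 ≤ (a : ℝ) / N - k / 2)).card : ℝ) ≤
      N * √((sin (π * (k / 2)) * T)⁻¹) + 1 := by
    apply card_le_of_diff _ _ (by positivity)
    intro a ha b hb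
    rw [Finset.mem_filter, not_le] at ha hb
    have hA := hS a ha.1
    have hB := hS b hb.1
    apply key
    rw [abs_le] at hA hB
    exact diff_bound k _ _ m T (-1) hT hs (Or.inr rfl) (by linarith) (by linarith [hA.1.1])
      (by linarith) (by linarith [hB.1.1]) hA.2 hB.2
  have h3 : (S.card : ℝ) = ((S.filter (fun a : ℤ => 0 ≤ (a : ℝ) / N - k / 2)).card : ℝ) +
      ((S.filter (fun a : ℤ => ¬ 0 ≤ (a : ℝ) / N - k / 2)).card : ℝ) := by
    exact_mod_cast (Finset.card_filter_add_card_filter_not _).symm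
  linarith

open scoped Classical in
/-- **Two-vector counting estimate, same-sign case (Proposition 4.3, first bound).**
For the sinusoidal dispersion relation `ω(k) = 2 sin(πk)`: uniformly in
`k ∈ ℤ_N ∩ (-1,2)` and `m ∈ ℝ`, the weighted count of lattice pairs
`(x,y) ∈ (ℤ_N ∩ (0,1))²` with `x + y = k` and `|sin(πx) + sin(πy) - m| ≤ T⁻¹` is at
most `C N T^{-1/2}`. -/
theorem two_vector_counting_plus (ε : ℝ) (hε : ε ∈ Set.Ioo (0 : ℝ) 1) :
    ∃ C : ℝ, ∀ (N : ℕ), 2 ≤ N → ∀ T : ℝ, 1 < T → T ≤ (N : ℝ) ^ (1 - ε) →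
      ∀ k : ℝ, (∃ a : ℤ, k = (a : ℝ) / N) → k ∈ Set.Ioo (-1 : ℝ) 2 → ∀ m : ℝ,
      (∑ a ∈ Finset.Ioo (0 : ℤ) N, ∑ b ∈ Finset.Ioo (0 : ℤ) N,
        if ((a : ℝ) / N + (b : ℝ) / N = k ∧
            |Real.sin (π * ((a : ℝ) / N)) + Real.sin (π * ((b : ℝ) / N)) - m| ≤ T⁻¹)
        then |Real.sin (π * ((a : ℝ) / N)) * Real.sin (π * (k - (a : ℝ) / N))|
        else 0)
        ≤ C * (N : ℝ) * T ^ (-(1 : ℝ) / 2) := by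
  obtain ⟨hε0, hε1⟩ := hε
  refine ⟨4, ?_⟩
  intro N hN T hT hTN k ⟨A, hk⟩ _ m
  have hN0 : 0 < N := by omega
  have hN' : (0 : ℝ) < N := by exact_mod_cast hN0
  have hN1 : (1 : ℝ) ≤ N := by exact_mod_cast hN0
  have hT0 : 0 < T := by linarith
  have hTN' : T ≤ N := by
    refine hTN.trans ?_
    calc (N : ℝ) ^ (1 - ε) ≤ (N : ℝ) ^ (1 : ℝ) :=
          Real.rpow_le_rpow_of_exponent_le hN1 (by linarith)
      _ = N := Real.rpow_one _
  have hTp : T ^ (-(1 : ℝ) / 2) = √(T⁻¹) := by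
    rw [Real.sqrt_inv, Real.sqrt_eq_rpow, ← Real.rpow_neg hT0.le]
    norm_num
  rw [hTp]
  have hone : 1 ≤ N * √(T⁻¹) := by
    have h1 : T⁻¹ ≤ √(T⁻¹) := by
      apply Real.le_sqrt_of_sq_le
      have : T⁻¹ ≤ 1 := inv_le_one_of_one_le₀ hT.le
      have : 0 < T⁻¹ := by positivity
      nlinarith
    calc (1 : ℝ) = T * T⁻¹ := by field_simp
      _ ≤ N * √(T⁻¹) := mul_le_mul hTN' h1 (by positivity) (by positivity)
  set s := Real.sin (π * (k / 2)) with hsdef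
  set S : Finset ℤ := (Finset.Ioo (0 : ℤ) N).filter (fun a : ℤ => A - a ∈ Finset.Ioo (0 : ℤ) N ∧
    |Real.sin (π * ((a : ℝ) / N)) + Real.sin (π * (k - (a : ℝ) / N)) - m| ≤ T⁻¹) with hSdef
  have hinner : ∀ a ∈ Finset.Ioo (0 : ℤ) N, (∑ b ∈ Finset.Ioo (0 : ℤ) N,
        if ((a : ℝ) / N + (b : ℝ) / N = k ∧
            |Real.sin (π * ((a : ℝ) / N)) + Real.sin (π * ((b : ℝ) / N)) - m| ≤ T⁻¹)
        then |Real.sin (π * ((a : ℝ) / N)) * Real.sin (π * (k - (a : ℝ) / N))|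
        else 0) = if (A - a ∈ Finset.Ioo (0 : ℤ) N ∧
    |Real.sin (π * ((a : ℝ) / N)) + Real.sin (π * (k - (a : ℝ) / N)) - m| ≤ T⁻¹) then
      |Real.sin (π * ((a : ℝ) / N)) * Real.sin (π * (k - (a : ℝ) / N))| else 0 := by
    intro a _
    have hiff : ∀ b : ℤ, (a : ℝ) / N + (b : ℝ) / N = k ↔ b = A - a := by
      intro b
      rw [hk, ← add_div, div_left_inj' hN'.ne']
      constructor
      · intro h
        have : a + b = A := by exact_mod_cast h
        omega
      · rintro rfl
        push_cast; ring
    have hb : ∀ b : ℤ, (if ((a : ℝ) / N + (b : ℝ) / N = k ∧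
            |Real.sin (π * ((a : ℝ) / N)) + Real.sin (π * ((b : ℝ) / N)) - m| ≤ T⁻¹)
        then |Real.sin (π * ((a : ℝ) / N)) * Real.sin (π * (k - (a : ℝ) / N))|
        else 0) = if b = A - a then (if
          |Real.sin (π * ((a : ℝ) / N)) + Real.sin (π * (k - (a : ℝ) / N)) - m| ≤ T⁻¹
          then |Real.sin (π * ((a : ℝ) / N)) * Real.sin (π * (k - (a : ℝ) / N))|
          else 0) else 0 := by
      intro b
      by_cases h : b = A - a
      · have h' := (hiff b).2 h
        have h'' : (b : ℝ) / N = k - (a : ℝ) / N := by linarith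
        rw [if_pos h, h'']
        simp
      · have h' := fun q => h ((hiff b).1 q)
        rw [if_neg h, if_neg (fun q => h' q.1)]
    rw [Finset.sum_congr rfl (fun b _ => hb b), Finset.sum_ite_eq', ite_and]
  rw [Finset.sum_congr rfl hinner, ← Finset.sum_filter]
  rw [← hSdef]
  have hmem : ∀ a ∈ S, 0 < (a : ℝ) / N ∧ (a : ℝ) / N < 1 ∧ 0 < k - (a : ℝ) / N ∧
      k - (a : ℝ) / N < 1 ∧
      |Real.sin (π * ((a : ℝ) / N)) + Real.sin (π * (k - (a : ℝ) / N)) - m| ≤ T⁻¹ := by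
    intro a ha
    rw [hSdef, Finset.mem_filter, Finset.mem_Ioo, Finset.mem_Ioo] at ha
    obtain ⟨⟨h1, h2⟩, ⟨h3, h4⟩, h5⟩ := ha
    have e : k - (a : ℝ) / N = ((A - a : ℤ) : ℝ) / N := by
      rw [hk]; push_cast; ring
    have h1' : (0 : ℝ) < a := by exact_mod_cast h1
    have h2' : (a : ℝ) < N := by exact_mod_cast h2
    have h3' : (0 : ℝ) < ((A - a : ℤ) : ℝ) := by exact_mod_cast h3
    have h4' : ((A - a : ℤ) : ℝ) < N := by exact_mod_cast h4
    refine ⟨by positivity, (div_lt_one hN').2 h2', ?_, ?_, h5⟩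
    · rw [e]; positivity
    · rw [e]; exact (div_lt_one hN').2 h4'
  rcases S.eq_empty_or_nonempty with hSe | ⟨a0, ha0⟩
  · rw [hSe, Finset.sum_empty]; positivity
  obtain ⟨p1, p2, p3, p4, -⟩ := hmem a0 ha0
  have hs : 0 < s := Real.sin_pos_of_pos_of_lt_pi (by have := pi_pos; apply mul_pos this; linarith)
    (by nlinarith [pi_pos])
  have hs1 : s ≤ 1 := Real.sin_le_one _
  have hw : ∀ a ∈ S, |Real.sin (π * ((a : ℝ) / N)) * Real.sin (π * (k - (a : ℝ) / N))| ≤ s := by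
    intro a ha
    obtain ⟨q1, q2, q3, q4, -⟩ := hmem a ha
    have r1 : 0 ≤ Real.sin (π * ((a : ℝ) / N)) :=
      Real.sin_nonneg_of_nonneg_of_le_pi (by positivity) (by nlinarith [pi_pos])
    have r2 : 0 ≤ Real.sin (π * (k - (a : ℝ) / N)) :=
      Real.sin_nonneg_of_nonneg_of_le_pi (by positivity) (by nlinarith [pi_pos])
    rw [abs_of_nonneg (mul_nonneg r1 r2)]
    have := prod_le k ((a : ℝ) / N)
    nlinarith
  have hcard := count_bound S N hN0 k m T hT0 hs (by
    intro a ha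
    obtain ⟨q1, q2, q3, q4, q5⟩ := hmem a ha
    refine ⟨?_, q5⟩
    rw [abs_le]; constructor <;> linarith)
  have hsum := Finset.sum_le_card_nsmul S _ s hw
  rw [nsmul_eq_mul] at hsum
  rw [← hsdef] at hcard
  have hq : s * √((s * T)⁻¹) ≤ √(T⁻¹) := by
    apply Real.le_sqrt_of_sq_le
    rw [mul_pow, Real.sq_sqrt (by positivity)]
    have : s ^ 2 * (s * T)⁻¹ = s * T⁻¹ := by field_simp
    rw [this]
    have : 0 < T⁻¹ := by positivity
    nlinarith
  calc _ ≤ (S.card : ℝ) * s := hsum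
    _ ≤ 2 * (N * √((s * T)⁻¹) + 1) * s := mul_le_mul_of_nonneg_right hcard hs.le
    _ = 2 * (N * (s * √((s * T)⁻¹))) + 2 * s := by ring
    _ ≤ 2 * (N * √(T⁻¹)) + 2 * (N * √(T⁻¹)) := by
        have := mul_le_mul_of_nonneg_left hq hN'.le
        linarith
    _ = 4 * N * √(T⁻¹) := by ring
end

section
/- Fix ε ∈ (0,1). There is a constant C = C(ε) such that for every integer N ≥ 2, every real T with 1 < T ≤ N^{1−ε}, every k ∈ ℤ_N ∩ (−1,2), and every m ∈ ℝ, the set S₂⁻ = {(x,y) ∈ ℤ_N² ∩ (0,1)² : x − y = k and |sin(πx) − sin(πy) − m| ≤ T^{−1}} satisfies: Σ_{(x,y)∈S₂⁻} |sin(πx) sin(π(k−x))| ≤ C N T^{−1/2} whenever |k| ≥ T^{−1/2}, and Σ_{(x,y)∈S₂⁻} |sin(πx) sin(π(k−x))| ≤ C N in all cases. -/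
open Real

lemma tvc_telescope (G : ℤ → ℝ) (hG : ∀ a, G (a + 1) ≤ G a) (N : ℕ) :
    ∑ a ∈ Finset.Ioo (0 : ℤ) N, (G a - G (a + 1)) ≤ G 0 - G N := by
  have hsub : Finset.Ioo (0 : ℤ) N ⊆ (Finset.range N).map Nat.castEmbedding := by
    intro a ha
    rw [Finset.mem_Ioo] at ha
    rw [Finset.mem_map]
    refine ⟨a.toNat, ?_, ?_⟩
    · rw [Finset.mem_range]; omega
    · simp; omega
  refine (Finset.sum_le_sum_of_subset_of_nonneg hsub
    (fun i _ _ => sub_nonneg.2 (hG i))).trans ?_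
  rw [Finset.sum_map]
  have := Finset.sum_range_sub' (fun i : ℕ => G (i : ℤ)) N
  simp only [Nat.cast_add, Nat.cast_one, Nat.cast_zero] at this
  simp only [Nat.castEmbedding_apply]
  rw [this]

open scoped Classical in
lemma tvc_inner (N : ℕ) (hN : 2 ≤ N) (a : ℤ) (k : ℝ) (P : ℤ → Prop) (w B : ℝ) (hB : 0 ≤ B)
    (h : ∀ b ∈ Finset.Ioo (0 : ℤ) N, (a : ℝ) / N - (b : ℝ) / N = k → P b → w ≤ B) :
    (∑ b ∈ Finset.Ioo (0 : ℤ) N, if ((a : ℝ) / N - (b : ℝ) / N = k ∧ P b) then w else 0) ≤ B := by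
  by_cases hex : ∃ b ∈ Finset.Ioo (0 : ℤ) N, (a : ℝ) / N - (b : ℝ) / N = k ∧ P b
  · obtain ⟨b, hb, hk, hP⟩ := hex
    rw [Finset.sum_eq_single b]
    · rw [if_pos ⟨hk, hP⟩]; exact h b hb hk hP
    · intro c _ hcb
      rw [if_neg]
      rintro ⟨hc, _⟩
      apply hcb
      have hN0 : (N : ℝ) ≠ 0 := by positivity
      have : (c : ℝ) / N = b / N := by linarith
      have := (div_left_inj' hN0).1 this
      exact_mod_cast this
    · intro h; exact absurd hb h
  · rw [Finset.sum_eq_zero]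
    · exact hB
    · intro b hb
      rw [if_neg]
      intro hc; exact hex ⟨b, hb, hc⟩

lemma tvc_weight (x y : ℝ) (hx : x ∈ Set.Ioo (0 : ℝ) 1) (hy : y ∈ Set.Ioo (0 : ℝ) 1) :
    |sin (π * x) * sin (π * (x - y - x))| ≤ sin (π * (x - (x - y) / 2)) := by
  have hpi := Real.pi_pos
  have e1 : π * (x - y - x) = -(π * y) := by ring
  have hsx : 0 ≤ sin (π * x) := sin_nonneg_of_nonneg_of_le_pi (by nlinarith [hx.1]) (by nlinarith [hx.2])
  have hsy : 0 ≤ sin (π * y) := sin_nonneg_of_nonneg_of_le_pi (by nlinarith [hy.1]) (by nlinarith [hy.2])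
  rw [e1, sin_neg, mul_neg, abs_neg, abs_of_nonneg (mul_nonneg hsx hsy)]
  set t := π * (x - (x - y) / 2) with ht
  set d := π * (x - y) / 2 with hd
  have ex : π * x = t + d := by rw [ht, hd]; ring
  have ey : π * y = t - d := by rw [ht, hd]; ring
  have h0 : 0 ≤ sin t := sin_nonneg_of_nonneg_of_le_pi (by rw [ht]; nlinarith [hx.1, hy.1])
    (by rw [ht]; nlinarith [hx.2, hy.2])
  have h1 := sin_le_one t
  rw [ex, ey, sin_add, sin_sub]
  have := sin_sq_add_cos_sq t
  have := sin_sq_add_cos_sq d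
  have : (sin t * cos d + cos t * sin d) * (sin t * cos d - cos t * sin d)
    = sin t ^ 2 - sin d ^ 2 := by
    have a1 : cos t ^ 2 = 1 - sin t ^ 2 := by linarith
    have a2 : cos d ^ 2 = 1 - sin d ^ 2 := by linarith
    calc _ = sin t ^ 2 * cos d ^ 2 - cos t ^ 2 * sin d ^ 2 := by ring
      _ = _ := by rw [a1, a2]; ring
  rw [this]
  nlinarith [sq_nonneg (sin d)]

/-- clamp -/
noncomputable def tvcClamp (lo hi t : ℝ) : ℝ := max lo (min t hi)

lemma tvcClamp_mono (lo hi : ℝ) : Monotone (tvcClamp lo hi) := by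
  intro a b h
  unfold tvcClamp
  gcongr

lemma tvcClamp_eq {lo hi t : ℝ} (h1 : lo ≤ t) (h2 : t ≤ hi) : tvcClamp lo hi t = t := by
  unfold tvcClamp
  rw [min_eq_left h2, max_eq_right h1]

lemma tvcClamp_mem {lo hi : ℝ} (h : lo ≤ hi) (t : ℝ) :
    lo ≤ tvcClamp lo hi t ∧ tvcClamp lo hi t ≤ hi :=
  ⟨le_max_left _ _, max_le h (min_le_right _ _)⟩

lemma tvc_step (N : ℕ) (hN : 2 ≤ N) (θ lo hi : ℝ) (h0 : 0 ≤ θ) (h1 : θ + π / N ≤ π)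
    (hlo : lo + π / N ≤ cos θ) (hhi : cos θ ≤ hi) :
    sin θ ≤ π / N / 2 + N / 2 * (tvcClamp lo hi (cos (tvcClamp 0 π θ))
      - tvcClamp lo hi (cos (tvcClamp 0 π (θ + π / N)))) := by
  have hpi := Real.pi_pos
  have hN0 : (2 : ℝ) ≤ N := by exact_mod_cast hN
  have hh : 0 < π / N := by positivity
  set h := π / N with hdef
  have hNh : N * h = π := by rw [hdef]; field_simp
  have hdiff : cos θ - cos (θ + h) = 2 * sin (θ + h / 2) * sin (h / 2) := by
    rw [cos_sub_cos]
    have e1 : (θ + (θ + h)) / 2 = θ + h / 2 := by ring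
    have e2 : (θ - (θ + h)) / 2 = -(h / 2) := by ring
    rw [e1, e2, sin_neg]; ring
  have s1 : 0 ≤ sin (θ + h / 2) := sin_nonneg_of_nonneg_of_le_pi (by linarith) (by linarith)
  have s1' := sin_le_one (θ + h / 2)
  have s2 : sin (h / 2) ≤ h / 2 := sin_le (by linarith)
  have s3 : 2 / π * (h / 2) ≤ sin (h / 2) := mul_le_sin (by linarith) (by linarith)
  have s4 : 2 / π * (h / 2) = 1 / N := by rw [hdef]; field_simp
  rw [s4] at s3
  have s5 : 0 ≤ sin (h / 2) := le_trans (by positivity) s3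
  have s6 : 1 ≤ N * sin (h / 2) := by
    rw [div_le_iff₀ (by positivity)] at s3; linarith
  have s7 : sin θ ≤ sin (θ + h / 2) + h / 2 := by
    have e : sin θ = sin (θ + h / 2) * cos (h / 2) - cos (θ + h / 2) * sin (h / 2) := by
      rw [← sin_sub]; congr 1; ring
    rw [e]
    have c1 := cos_le_one (h / 2)
    have c2 := neg_one_le_cos (θ + h / 2)
    nlinarith
  rw [tvcClamp_eq h0 (by linarith), tvcClamp_eq (by linarith) h1,
    tvcClamp_eq (by linarith) hhi, tvcClamp_eq (t := cos (θ + h)) (by nlinarith) (by nlinarith), hdiff]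
  nlinarith

lemma tvc_condition (x y m s : ℝ) (hs : 0 < s) (hk : s ≤ |x - y|) (hk1 : |x - y| ≤ 1)
    (h : |sin (π * x) - sin (π * y) - m| ≤ s ^ 2) :
    |cos (π * (x - (x - y) / 2)) - m / (2 * sin (π * (x - y) / 2))| ≤ s / 2 := by
  have hpi := Real.pi_pos
  set S := 2 * sin (π * (x - y) / 2) with hS
  have hab : |π * (x - y) / 2| = π * |x - y| / 2 := by
    rw [abs_div, abs_mul, abs_of_pos hpi, abs_of_pos (by norm_num : (0:ℝ) < 2)]
  have h1 := mul_abs_le_abs_sin (x := π * (x - y) / 2) (by rw [hab]; nlinarith)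
  rw [hab] at h1
  have h2 : 2 / π * (π * |x - y| / 2) = |x - y| := by field_simp
  rw [h2] at h1
  have hSabs : 2 * s ≤ |S| := by
    rw [hS, abs_mul, abs_of_pos (by norm_num : (0:ℝ) < 2)]; linarith
  have hS0 : S ≠ 0 := by
    intro h; rw [h, abs_zero] at hSabs; linarith
  have e : sin (π * x) - sin (π * y) - m
      = S * (cos (π * (x - (x - y) / 2)) - m / S) := by
    rw [mul_sub, mul_div_cancel₀ _ hS0, sin_sub_sin, hS]
    congr 3
    · congr 1; ring
    · ring
  rw [e, abs_mul] at h
  have := abs_nonneg (cos (π * (x - (x - y) / 2)) - m / S)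
  by_contra hc
  push Not at hc
  nlinarith

open scoped Classical in
/-- **Two-vector counting estimate, opposite-sign case (Proposition 4.3, second bound).**
For the sinusoidal dispersion relation `ω(k) = 2 sin(πk)`: uniformly in
`k ∈ ℤ_N ∩ (-1,2)` and `m ∈ ℝ`, the weighted count of lattice pairs
`(x,y) ∈ (ℤ_N ∩ (0,1))²` with `x - y = k` and `|sin(πx) - sin(πy) - m| ≤ T⁻¹` is at
most `C N T^{-1/2}` whenever `|k| ≥ T^{-1/2}`, and at most `C N` in all cases. -/
theorem two_vector_counting_minus (ε : ℝ) (hε : ε ∈ Set.Ioo (0 : ℝ) 1) :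
    ∃ C : ℝ, ∀ (N : ℕ), 2 ≤ N → ∀ T : ℝ, 1 < T → T ≤ (N : ℝ) ^ (1 - ε) →
      ∀ k : ℝ, (∃ a : ℤ, k = (a : ℝ) / N) → k ∈ Set.Ioo (-1 : ℝ) 2 → ∀ m : ℝ,
      ((|k| ≥ T ^ (-(1 : ℝ) / 2) →
        (∑ a ∈ Finset.Ioo (0 : ℤ) N, ∑ b ∈ Finset.Ioo (0 : ℤ) N,
          if ((a : ℝ) / N - (b : ℝ) / N = k ∧
              |Real.sin (π * ((a : ℝ) / N)) - Real.sin (π * ((b : ℝ) / N)) - m| ≤ T⁻¹)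
          then |Real.sin (π * ((a : ℝ) / N)) * Real.sin (π * (k - (a : ℝ) / N))|
          else 0)
          ≤ C * (N : ℝ) * T ^ (-(1 : ℝ) / 2)) ∧
      (∑ a ∈ Finset.Ioo (0 : ℤ) N, ∑ b ∈ Finset.Ioo (0 : ℤ) N,
        if ((a : ℝ) / N - (b : ℝ) / N = k ∧
            |Real.sin (π * ((a : ℝ) / N)) - Real.sin (π * ((b : ℝ) / N)) - m| ≤ T⁻¹)
        then |Real.sin (π * ((a : ℝ) / N)) * Real.sin (π * (k - (a : ℝ) / N))|
        else 0)
        ≤ C * (N : ℝ)) := by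
  refine ⟨5, ?_⟩
  intro N hN T hT hTN k _ _ m
  have hpi := Real.pi_pos
  have hN2 : (2 : ℝ) ≤ N := by exact_mod_cast hN
  constructor
  · intro hk
    set s := T ^ (-(1 : ℝ) / 2) with hs
    have hs0 : 0 < s := by positivity
    have hs2 : s ^ 2 = T⁻¹ := by
      rw [hs, ← rpow_natCast, ← rpow_mul (by linarith), ← rpow_neg_one]
      norm_num
    have hTN' : T ≤ N := by
      refine hTN.trans ?_
      calc (N : ℝ) ^ (1 - ε) ≤ (N : ℝ) ^ (1 : ℝ) :=
            rpow_le_rpow_of_exponent_le (by linarith) (by linarith [hε.1])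
        _ = N := rpow_one _
    have hNs2 : 1 ≤ N * s ^ 2 := by
      rw [hs2, ← div_eq_mul_inv, le_div_iff₀ (by linarith)]; linarith
    have hNs : 1 ≤ N * s := by
      have hs1 : s ≤ 1 := by
        have : T⁻¹ ≤ 1 := inv_le_one_of_one_le₀ hT.le
        nlinarith
      nlinarith
    set m' := m / (2 * sin (π * k / 2)) with hm'
    set lo := m' - s / 2 - π / N with hlo
    set hi := m' + s / 2 with hhi
    set θ : ℤ → ℝ := fun a => π * ((a : ℝ) / N - k / 2) with hθ
    have hθs : ∀ a, θ (a + 1) = θ a + π / N := by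
      intro a; simp only [hθ]; push_cast; ring
    set G : ℤ → ℝ := fun a => tvcClamp lo hi (cos (tvcClamp 0 π (θ a))) with hGdef
    have hh : 0 < π / N := by positivity
    have hG : ∀ a, G (a + 1) ≤ G a := by
      intro a
      apply tvcClamp_mono
      apply cos_le_cos_of_nonneg_of_le_pi
      · exact (tvcClamp_mem hpi.le _).1
      · exact (tvcClamp_mem hpi.le _).2
      · apply tvcClamp_mono
        rw [hθs]; linarith
    have hterm : ∀ a ∈ Finset.Ioo (0 : ℤ) N, (∑ b ∈ Finset.Ioo (0 : ℤ) N,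
          if ((a : ℝ) / N - (b : ℝ) / N = k ∧
              |Real.sin (π * ((a : ℝ) / N)) - Real.sin (π * ((b : ℝ) / N)) - m| ≤ T⁻¹)
          then |Real.sin (π * ((a : ℝ) / N)) * Real.sin (π * (k - (a : ℝ) / N))|
          else 0) ≤ π / N / 2 + N / 2 * (G a - G (a + 1)) := by
      intro a ha
      apply tvc_inner N hN a k
      · have := hG a
        have : 0 ≤ N / 2 * (G a - G (a + 1)) := mul_nonneg (by positivity) (by linarith)
        linarith
      · intro b hb hab hcond
        rw [Finset.mem_Ioo] at ha hb
        have key : ∀ c : ℤ, 0 < c ∧ c < (N : ℤ) → 0 < (c : ℝ) / N ∧ (c : ℝ) / N + 1 / N ≤ 1 := by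
          intro c hc
          refine ⟨div_pos (by exact_mod_cast hc.1) (by linarith), ?_⟩
          rw [← add_div, div_le_one (by linarith)]
          exact_mod_cast hc.2
        obtain ⟨ha1, ha2⟩ := key a ha
        obtain ⟨hb1, hb2⟩ := key b hb
        have h1N : 0 < 1 / (N : ℝ) := by positivity
        have hk1 : |(a : ℝ) / N - (b : ℝ) / N| ≤ 1 := by
          rw [abs_le]; constructor <;> linarith
        have hw := tvc_weight ((a : ℝ) / N) ((b : ℝ) / N) ⟨ha1, by linarith⟩ ⟨hb1, by linarith⟩
        have hc := tvc_condition ((a : ℝ) / N) ((b : ℝ) / N) m s hs0 (by rw [hab]; exact hk) hk1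
          (by rw [hs2]; exact hcond)
        rw [hab] at hw hc
        refine hw.trans ?_
        simp only [hGdef]
        rw [hθs]
        rw [abs_le] at hc
        have hpn : π / N = π * (1 / N) := by ring
        apply tvc_step N hN
        · apply mul_nonneg hpi.le
          linarith
        · rw [hpn]
          nlinarith
        · linarith [hc.1]
        · linarith [hc.2]
    refine (Finset.sum_le_sum hterm).trans ?_
    rw [Finset.sum_add_distrib, ← Finset.mul_sum, Finset.sum_const, nsmul_eq_mul]
    have htel := tvc_telescope G hG N
    have hlohi : lo ≤ hi := by linarith
    have g0 : G 0 ≤ hi := (tvcClamp_mem hlohi _).2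
    have gN : lo ≤ G N := (tvcClamp_mem hlohi _).1
    have hcard : ((Finset.Ioo (0 : ℤ) N).card : ℝ) ≤ N := by
      have h : (Finset.Ioo (0 : ℤ) N).card ≤ N := by rw [Int.card_Ioo]; omega
      exact_mod_cast h
    have hNh : N * (π / N) = π := by field_simp
    have t1 : ((Finset.Ioo (0 : ℤ) N).card : ℝ) * (π / N / 2) ≤ N * (π / N / 2) := by gcongr
    have t2 : (N : ℝ) / 2 * ∑ a ∈ Finset.Ioo (0 : ℤ) N, (G a - G (a + 1))
        ≤ N / 2 * (s + π / N) := by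
      gcongr
      linarith
    have := pi_lt_four
    nlinarith
  · have hterm : ∀ a ∈ Finset.Ioo (0 : ℤ) N, (∑ b ∈ Finset.Ioo (0 : ℤ) N,
          if ((a : ℝ) / N - (b : ℝ) / N = k ∧
              |Real.sin (π * ((a : ℝ) / N)) - Real.sin (π * ((b : ℝ) / N)) - m| ≤ T⁻¹)
          then |Real.sin (π * ((a : ℝ) / N)) * Real.sin (π * (k - (a : ℝ) / N))|
          else 0) ≤ 1 := by
      intro a ha
      apply tvc_inner N hN a k _ _ _ zero_le_one
      intro b _ _ _
      rw [abs_mul]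
      exact mul_le_one₀ (abs_sin_le_one _) (abs_nonneg _) (abs_sin_le_one _)
    refine (Finset.sum_le_sum hterm).trans ?_
    rw [Finset.sum_const, nsmul_eq_mul]
    have hcard : ((Finset.Ioo (0 : ℤ) N).card : ℝ) ≤ N := by
      have h : (Finset.Ioo (0 : ℤ) N).card ≤ N := by rw [Int.card_Ioo]; omega
      exact_mod_cast h
    linarith
end

section
/- Let n, m₂, m₃, m₋₁ be nonnegative integers with m₃ ≤ n, satisfying 2m₃ + m₂ = n − m₋₁ and 5m₃ − 3 ≥ n − m₋₁, and let N, T be reals with e ≤ T ≤ N. Then (N² T^{−1} log T)^{m₃} · N^{m₂} · N^{m₋₁/2} ≤ N^n (log T)^n T^{−n/5 − 3/5}. -/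
/-- **Proposition 5.10 (arithmetic core).**
Combining `m3` three-vector countings (each costing `N^2 * T⁻¹ * log T`), `m2` two-vector
countings (each costing `N`), and `mneg` degenerate-atom removals (costing `N^(mneg/2)`)
yields the decoration-counting bound `N^n * (log T)^n * T^(-n/5 - 3/5)` in the regime
`e ≤ T ≤ N`, given the Euler-characteristic identity `2*m3 + m2 = n - mneg` and the
operation inequality `5*m3 - 3 ≥ n - mneg`. -/
theorem decoration_counting_bound (n m2 m3 mneg : ℕ) (hm3n : m3 ≤ n)
    (h2 : 2 * (m3 : ℤ) + (m2 : ℤ) = (n : ℤ) - (mneg : ℤ))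
    (h5 : 5 * (m3 : ℤ) - 3 ≥ (n : ℤ) - (mneg : ℤ))
    (N T : ℝ) (hT : Real.exp 1 ≤ T) (hTN : T ≤ N) :
    (N ^ 2 * T⁻¹ * Real.log T) ^ m3 * N ^ m2 * N ^ ((mneg : ℝ) / 2)
      ≤ N ^ n * Real.log T ^ n * T ^ (-(n : ℝ) / 5 - 3 / 5) := by
  have hT1 : 1 ≤ T := le_trans (by have := Real.add_one_le_exp (1 : ℝ); linarith) hT
  have hT0 : 0 < T := by linarith
  have hN0 : 0 < N := by linarith
  have hL : 1 ≤ Real.log T := (Real.le_log_iff_exp_le hT0).2 hT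
  have hn : n = 2 * m3 + m2 + mneg := by omega
  have h5' : (n : ℝ) + 3 ≤ 5 * m3 + mneg := by
    have : n + 3 ≤ 5 * m3 + mneg := by omega
    exact_mod_cast this
  have hk : (0 : ℝ) ≤ mneg := Nat.cast_nonneg _
  have hNk : N ^ mneg = N ^ ((mneg : ℝ) / 2) * N ^ ((mneg : ℝ) / 2) := by
    rw [← Real.rpow_add hN0, add_halves, Real.rpow_natCast]
  have hTm : (T⁻¹) ^ m3 = T ^ (-(m3 : ℝ)) := by
    rw [Real.rpow_neg hT0.le, Real.rpow_natCast, inv_pow]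
  have key : (T⁻¹) ^ m3 ≤ N ^ ((mneg : ℝ) / 2) * T ^ (-(n : ℝ) / 5 - 3 / 5) := by
    calc (T⁻¹) ^ m3 = T ^ (-(m3 : ℝ)) := hTm
      _ ≤ T ^ ((mneg : ℝ) / 2 + (-(n : ℝ) / 5 - 3 / 5)) :=
        Real.rpow_le_rpow_of_exponent_le hT1 (by linarith)
      _ = T ^ ((mneg : ℝ) / 2) * T ^ (-(n : ℝ) / 5 - 3 / 5) := Real.rpow_add hT0 _ _
      _ ≤ _ := by gcongr
  have hLp : Real.log T ^ m3 ≤ Real.log T ^ n := pow_le_pow_right₀ hL hm3n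
  have hNn : N ^ n = N ^ (2 * m3 + m2) * (N ^ ((mneg : ℝ) / 2) * N ^ ((mneg : ℝ) / 2)) := by
    rw [← hNk, ← pow_add, ← hn]
  have hL0 : 0 ≤ Real.log T := by linarith
  calc (N ^ 2 * T⁻¹ * Real.log T) ^ m3 * N ^ m2 * N ^ ((mneg : ℝ) / 2)
      = N ^ (2 * m3 + m2) * N ^ ((mneg : ℝ) / 2) * (Real.log T ^ m3 * (T⁻¹) ^ m3) := by
        rw [mul_pow, mul_pow, ← pow_mul, pow_add]; ring
    _ ≤ N ^ (2 * m3 + m2) * N ^ ((mneg : ℝ) / 2) * (Real.log T ^ n *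
          (N ^ ((mneg : ℝ) / 2) * T ^ (-(n : ℝ) / 5 - 3 / 5))) := by gcongr
    _ = _ := by rw [hNn]; ring
end

section
/- Let T ≥ 1, β > 0, C₀ ≥ 0 and K ≥ 0 be reals with βT^{4/5} ≤ 1 and β(C₀ + K) ≤ 1/2, let Ω ∈ ℝ and ζ ∈ {+1,−1}, and let A_≥ : [0,1] → ℝ be twice differentiable with |A_≥'(s)| ≤ KβT and |A_≥''(s)| ≤ KβT^{9/5} for all s ∈ [0,1]. Let f : [0,T] → ℂ be C¹ with sup_{0≤s≤1}|f(Ts)| ≤ D and sup_{0≤s≤1}|(d/ds)f(Ts)| ≤ D. Then there is a constant C depending only on C₀ and K such that for all s ∈ [0,1]: | ∫₀^s e^{iζΩ(Ts' + C₀βTs' + A_≥(s'))} f(Ts') ds' | ≤ C D (1 + βT^{4/5}) ⟨TΩ⟩^{−1}. -/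
open MeasureTheory intervalIntegral Complex

theorem osc_aux (c : ℂ) (w : ℝ) (hw : 0 < w) (hc : ‖c‖ = w) (hre : c.re = 0)
    (p g g' : ℝ → ℝ) (F F' : ℝ → ℂ) (m B D : ℝ) (hm : 0 < m) (hB : 0 ≤ B)
    (hp : ∀ s ∈ Set.Icc (0 : ℝ) 1, HasDerivWithinAt p (g s) (Set.Icc (0 : ℝ) 1) s)
    (hg : ∀ s ∈ Set.Icc (0 : ℝ) 1, HasDerivWithinAt g (g' s) (Set.Icc (0 : ℝ) 1) s)
    (hF : ∀ s ∈ Set.Icc (0 : ℝ) 1, HasDerivWithinAt F (F' s) (Set.Icc (0 : ℝ) 1) s)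
    (hgm : ∀ s ∈ Set.Icc (0 : ℝ) 1, m ≤ g s)
    (hgB : ∀ s ∈ Set.Icc (0 : ℝ) 1, |g' s| ≤ B)
    (hFD : ∀ s ∈ Set.Icc (0 : ℝ) 1, ‖F s‖ ≤ D)
    (hFD' : ∀ s ∈ Set.Icc (0 : ℝ) 1, ‖F' s‖ ≤ D) (s : ℝ) (hs : s ∈ Set.Icc (0 : ℝ) 1) :
    ‖∫ x in (0 : ℝ)..s, Complex.exp (c * p x) * F x‖ ≤
      (3 * D / m + D * B / m ^ 2) / w := by
  have hD : 0 ≤ D := (norm_nonneg _).trans (hFD s hs)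
  have hc0 : c ≠ 0 := by
    intro h; rw [h, norm_zero] at hc; linarith
  have hnorm : ∀ x, ‖Complex.exp (c * p x)‖ = 1 := by
    intro x
    rw [Complex.norm_exp]
    simp [hre]
  have he : ∀ s ∈ Set.Icc (0 : ℝ) 1, HasDerivWithinAt (fun x => Complex.exp (c * p x))
      (Complex.exp (c * p s) * (c * g s)) (Set.Icc (0 : ℝ) 1) s := by
    intro s hs
    exact ((hp s hs).ofReal_comp.const_mul c).cexp
  have hcont : ContinuousOn (fun x => Complex.exp (c * p x) * F x) (Set.Icc (0 : ℝ) 1) :=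
    fun s hs => (he s hs).continuousWithinAt.mul (hF s hs).continuousWithinAt
  have hI : ∀ s ∈ Set.Icc (0 : ℝ) 1, HasDerivWithinAt
      (fun u => ∫ x in (0 : ℝ)..u, Complex.exp (c * p x) * F x)
      (Complex.exp (c * p s) * F s) (Set.Icc (0 : ℝ) 1) s := by
    intro s hs
    have : Fact (s ∈ Set.Icc (0 : ℝ) 1) := ⟨hs⟩
    refine intervalIntegral.integral_hasDerivWithinAt_right ?_ ?_ (hcont s hs)
    · apply ContinuousOn.intervalIntegrable
      rw [Set.uIcc_of_le hs.1]
      exact hcont.mono (Set.Icc_subset_Icc_right hs.2)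
    · exact hcont.stronglyMeasurableAtFilter_nhdsWithin measurableSet_Icc s
  have hgpos : ∀ s ∈ Set.Icc (0 : ℝ) 1, 0 < g s := fun s hs => hm.trans_le (hgm s hs)
  have hg0 : ∀ s ∈ Set.Icc (0 : ℝ) 1, (g s : ℂ) ≠ 0 := fun s hs => by
    exact_mod_cast (hgpos s hs).ne'
  have hH : ∀ s ∈ Set.Icc (0 : ℝ) 1, HasDerivWithinAt
      (fun x => Complex.exp (c * p x) * (F x / (c * g x)))
      (Complex.exp (c * p s) * F s +
        Complex.exp (c * p s) * (F' s / (c * g s) - F s * g' s / (c * g s ^ 2)))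
      (Set.Icc (0 : ℝ) 1) s := by
    intro s hs
    have h0 := hg0 s hs
    have h1 := (he s hs).mul ((hF s hs).div ((hg s hs).ofReal_comp.const_mul c)
      (mul_ne_zero hc0 h0))
    refine h1.congr_deriv ?_
    simp only [Pi.div_apply]
    field_simp
  have hq : ∀ s ∈ Set.Icc (0 : ℝ) 1, ‖Complex.exp (c * p s) * (F s / (c * g s))‖ ≤ D / m / w := by
    intro s hs
    have h0 := hgpos s hs
    rw [norm_mul, hnorm, one_mul, norm_div, norm_mul, hc, Complex.norm_real, Real.norm_eq_abs,
      abs_of_pos h0, div_div, mul_comm w]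
    have := hgm s hs
    have := hFD s hs
    gcongr
  have key := norm_image_sub_le_of_norm_deriv_le_segment' (a := (0 : ℝ)) (b := 1)
    (C := (D / m + D * B / m ^ 2) / w)
    (fun s hs => (hI s hs).sub (hH s hs)) (by
      intro s hs'
      have hs : s ∈ Set.Icc (0 : ℝ) 1 := ⟨hs'.1, hs'.2.le⟩
      have h0 := hgpos s hs
      have h1 := hgm s hs
      have h2 := hFD s hs
      have h3 := hFD' s hs
      have h4 := hgB s hs
      rw [sub_add_cancel_left, norm_neg, norm_mul, hnorm, one_mul]
      refine (norm_sub_le _ _).trans ?_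
      simp only [norm_div, norm_mul, norm_pow, hc, Complex.norm_real, Real.norm_eq_abs,
        abs_of_pos h0]
      rw [add_div, div_div, div_div, mul_comm w, mul_comm w]
      gcongr) s hs
  simp only [intervalIntegral.integral_same, zero_sub, Pi.sub_apply] at key
  have e1 := hq s hs
  have e2 := hq 0 ⟨le_rfl, zero_le_one⟩
  have hX : 0 ≤ (D / m + D * B / m ^ 2) / w := by positivity
  have hs1 : (D / m + D * B / m ^ 2) / w * (s - 0) ≤ (D / m + D * B / m ^ 2) / w := by
    nlinarith [hs.1, hs.2]
  have hsplit : (3 * D / m + D * B / m ^ 2) / w =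
    (D / m + D * B / m ^ 2) / w + D / m / w + D / m / w := by ring
  rw [hsplit]
  generalize (∫ x in (0 : ℝ)..s, Complex.exp (c * p x) * F x) = J at *
  generalize Complex.exp (c * p s) * (F s / (c * g s)) = u at *
  generalize Complex.exp (c * p 0) * (F 0 / (c * g 0)) = v at *
  have : J = (J - u - -v) + u - v := by ring
  rw [this]
  refine (norm_sub_le _ _).trans ?_
  refine add_le_add ((norm_add_le _ _).trans (add_le_add ?_ e1)) e2
  exact key.trans hs1

/-- **Base case of the integration-by-parts estimate (proof of Proposition 3.1).**
A single oscillatory time integral whose phase carries the linear modulation `TΩ` and the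
unconserved nonlinear frequency shift `Ω(C₀βTs + A_≥(s))` gains the full factor
`⟨TΩ⟩⁻¹`, with constant depending only on `C₀` and `K`. -/
theorem single_oscillatory_integral_estimate (C0 K : ℝ) (hC0 : 0 ≤ C0) (hK : 0 ≤ K) :
    ∃ C : ℝ, 0 < C ∧
      ∀ (T β : ℝ), 1 ≤ T → 0 < β → β * T ^ ((4 : ℝ) / 5) ≤ 1 → β * (C0 + K) ≤ 1 / 2 →
      ∀ (Ω ζ : ℝ), (ζ = 1 ∨ ζ = -1) →
      ∀ (A A' A'' : ℝ → ℝ),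
        (∀ s ∈ Set.Icc (0 : ℝ) 1, HasDerivWithinAt A (A' s) (Set.Icc (0 : ℝ) 1) s) →
        (∀ s ∈ Set.Icc (0 : ℝ) 1, HasDerivWithinAt A' (A'' s) (Set.Icc (0 : ℝ) 1) s) →
        (∀ s ∈ Set.Icc (0 : ℝ) 1, |A' s| ≤ K * β * T) →
        (∀ s ∈ Set.Icc (0 : ℝ) 1, |A'' s| ≤ K * β * T ^ ((9 : ℝ) / 5)) →
      ∀ (f f' : ℝ → ℂ) (D : ℝ),
        (∀ x ∈ Set.Icc (0 : ℝ) T, HasDerivWithinAt f (f' x) (Set.Icc (0 : ℝ) T) x) →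
        (∀ s ∈ Set.Icc (0 : ℝ) 1, ‖f (T * s)‖ ≤ D) →
        (∀ s ∈ Set.Icc (0 : ℝ) 1, ‖(T : ℂ) * f' (T * s)‖ ≤ D) →
      ∀ s ∈ Set.Icc (0 : ℝ) 1,
        ‖∫ s' in (0 : ℝ)..s,
            Complex.exp (Complex.I * ζ * Ω * (T * s' + (C0 * β * T * s' + A s')))
              * f (T * s')‖
          ≤ C * D * (1 + β * T ^ ((4 : ℝ) / 5)) * (Real.sqrt (1 + (T * Ω) ^ 2))⁻¹ := by
  refine ⟨12 + 8 * K, by positivity, ?_⟩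
  intro T β hT hβ hb1 hb2 Ω ζ hζ A A' A'' hA hA' hAb hAb' f f' D hf hfD hfD' s hs
  have hT0 : 0 < T := by linarith
  have hζ1 : |ζ| = 1 := by rcases hζ with h | h <;> simp [h]
  have hD : 0 ≤ D := (norm_nonneg _).trans (hfD s hs)
  have hT95 : T ^ ((9 : ℝ) / 5) = T * T ^ ((4 : ℝ) / 5) := by
    rw [show (9 : ℝ) / 5 = 1 + 4 / 5 by norm_num, Real.rpow_add hT0, Real.rpow_one]
  rw [hT95] at hAb'
  have hb0 : 0 < T ^ ((4 : ℝ) / 5) := Real.rpow_pos_of_pos hT0 _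
  generalize T ^ ((4 : ℝ) / 5) = r at *
  have hbr : 0 < β * r := by positivity
  have hint : (∫ s' in (0 : ℝ)..s,
            Complex.exp (Complex.I * ζ * Ω * (T * s' + (C0 * β * T * s' + A s')))
              * f (T * s')) = ∫ x in (0 : ℝ)..s,
      Complex.exp ((Complex.I * ζ * Ω) * ((T * x + (C0 * β * T * x + A x) : ℝ) : ℂ))
        * f (T * x) := by
    push_cast; rfl
  rw [hint]
  have hsq : 0 < Real.sqrt (1 + (T * Ω) ^ 2) := Real.sqrt_pos.2 (by positivity)
  rw [← div_eq_mul_inv, le_div_iff₀ hsq]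
  by_cases hΩ : 1 ≤ T * |Ω|
  · have hΩ0 : 0 < |Ω| := by
      by_contra h
      have : |Ω| = 0 := le_antisymm (not_lt.1 h) (abs_nonneg _)
      rw [this] at hΩ; linarith
    have main := osc_aux (Complex.I * ζ * Ω) |Ω| hΩ0 (by simp [hζ1]) (by simp)
      (fun x => T * x + (C0 * β * T * x + A x)) (fun x => T + (C0 * β * T + A' x)) A''
      (fun x => f (T * x)) (fun x => (T : ℂ) * f' (T * x)) (T / 2) (K * β * (T * r)) D
      (by positivity) (by positivity)
      (by
        intro x hx
        have h1 := (hasDerivWithinAt_id x (Set.Icc (0 : ℝ) 1)).const_mul T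
        have h2 := (hasDerivWithinAt_id x (Set.Icc (0 : ℝ) 1)).const_mul (C0 * β * T)
        have h3 := h1.add (h2.add (hA x hx))
        simp only [mul_one] at h3
        exact h3)
      (by
        intro x hx
        exact ((hA' x hx).const_add _).const_add _)
      (by
        intro x hx
        have hmaps : Set.MapsTo (fun x : ℝ => T * x) (Set.Icc 0 1) (Set.Icc 0 T) := by
          intro y hy
          exact ⟨mul_nonneg hT0.le hy.1, by nlinarith [hy.2]⟩
        have h1 : HasDerivWithinAt (fun x : ℝ => T * x) T (Set.Icc (0 : ℝ) 1) x := by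
          simpa using (hasDerivWithinAt_id x (Set.Icc (0 : ℝ) 1)).const_mul T
        have h2 := (hf (T * x) (hmaps hx)).scomp x h1 hmaps
        rw [Complex.real_smul] at h2
        exact h2)
      (by
        intro x hx
        have h1 := (abs_le.1 (hAb x hx)).1
        have h2 : 0 ≤ C0 * β * T := by positivity
        have h3 : 0 ≤ β * C0 := by positivity
        have h4 : K * β * T ≤ 1 / 2 * T := by
          apply mul_le_mul_of_nonneg_right _ hT0.le
          nlinarith
        linarith)
      hAb' hfD hfD' s hs
    have hsqle : Real.sqrt (1 + (T * Ω) ^ 2) ≤ 2 * (T * |Ω|) := by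
      apply Real.sqrt_le_iff.2 ⟨by positivity, ?_⟩
      have : (T * Ω) ^ 2 = (T * |Ω|) ^ 2 := by rw [mul_pow, mul_pow, sq_abs]
      rw [this]; nlinarith
    calc _ ≤ (3 * D / (T / 2) + D * (K * β * (T * r)) / (T / 2) ^ 2) / |Ω| * (2 * (T * |Ω|)) := by
          gcongr
      _ = 12 * D + 8 * K * (D * (β * r)) := by field_simp; ring
      _ ≤ _ := by
        have : 0 ≤ D * (β * r) := by positivity
        have : 0 ≤ K * D := by positivity
        nlinarith
  · have htriv : ‖∫ x in (0 : ℝ)..s,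
      Complex.exp ((Complex.I * ζ * Ω) * ((T * x + (C0 * β * T * x + A x) : ℝ) : ℂ))
        * f (T * x)‖ ≤ D := by
      have := intervalIntegral.norm_integral_le_of_norm_le_const (a := (0 : ℝ)) (b := s) (C := D)
        (f := fun x => Complex.exp ((Complex.I * ζ * Ω) *
          ((T * x + (C0 * β * T * x + A x) : ℝ) : ℂ)) * f (T * x)) (by
          intro x hx
          rw [Set.uIoc_of_le hs.1] at hx
          have hn : ‖Complex.exp ((Complex.I * ζ * Ω) *
              ((T * x + (C0 * β * T * x + A x) : ℝ) : ℂ))‖ = 1 := by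
            rw [Complex.norm_exp, Complex.re_mul_ofReal]
            simp
          rw [norm_mul, hn, one_mul]
          exact hfD x ⟨hx.1.le, hx.2.trans hs.2⟩)
      refine this.trans ?_
      rw [sub_zero, abs_of_nonneg hs.1]
      nlinarith [hs.2]
    have hsqle : Real.sqrt (1 + (T * Ω) ^ 2) ≤ 2 := by
      apply Real.sqrt_le_iff.2 ⟨by positivity, ?_⟩
      have h1 : (T * Ω) ^ 2 = (T * |Ω|) ^ 2 := by rw [mul_pow, mul_pow, sq_abs]
      have h2 : 0 ≤ T * |Ω| := by positivity
      rw [h1]; nlinarith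
    calc _ ≤ D * 2 := by gcongr
      _ ≤ _ := by
        have : 0 ≤ D * (β * r) := by positivity
        have : 0 ≤ K * D := by positivity
        have : 0 ≤ K * (D * (β * r)) := by positivity
        nlinarith
end

section
/- There is an absolute constant C such that for every bounded, continuously differentiable function f : ℝ → ℂ with bounded derivative, and every real t ≥ 1: | t ∫_ℝ (sin(tx/2)/(tx/2))² f(x) dx − 2π f(0) | ≤ C (‖f‖_∞ + ‖f'‖_∞) t^{−1/2}. -/
open MeasureTheory Real

lemma fk_bound (u : ℝ) : (Real.sin u / u) ^ 2 ≤ 4 * ((1 + |u|) ^ 2)⁻¹ := by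
  have hpos : 0 < (1 + |u|) ^ 2 := by positivity
  rw [← div_eq_mul_inv, le_div_iff₀ hpos]
  rcases eq_or_ne u 0 with rfl | hu
  · simp
  have h0 : 0 < u ^ 2 := by positivity
  have h1 : Real.sin u ^ 2 ≤ 1 := Real.sin_sq_le_one u
  have h2 : Real.sin u ^ 2 ≤ u ^ 2 := sq_le_sq.2 (Real.abs_sin_le_abs)
  rw [div_pow, div_mul_eq_mul_div, div_le_iff₀ h0]
  have h3 : u ^ 2 = |u| ^ 2 := (sq_abs u).symm
  have h4 : (1 + |u|) ^ 2 ≤ 2 + 2 * u ^ 2 := by rw [h3]; nlinarith [sq_nonneg (1 - |u|)]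
  nlinarith [sq_nonneg (Real.sin u)]

lemma fk_meas : Measurable (fun u : ℝ => (Real.sin u / u) ^ 2) := by
  fun_prop

lemma fk_integrable : Integrable (fun u : ℝ => (Real.sin u / u) ^ 2) := by
  have h := (integrable_one_add_norm (E := ℝ) (μ := volume) (r := 2) (by simp)).const_mul 4
  refine h.mono' fk_meas.aestronglyMeasurable (Filter.Eventually.of_forall fun u => ?_)
  rw [Real.norm_of_nonneg (by positivity)]
  refine (fk_bound u).trans (le_of_eq ?_)
  rw [Real.norm_eq_abs, Real.rpow_neg (by positivity)]
  norm_num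

lemma fk_integrable_sqrt : Integrable (fun u : ℝ => (Real.sin u / u) ^ 2 * √|u|) := by
  have h := (integrable_one_add_norm (E := ℝ) (μ := volume) (r := 3/2)
    (by simp; norm_num)).const_mul 4
  refine h.mono' (by fun_prop) (Filter.Eventually.of_forall fun u => ?_)
  rw [Real.norm_of_nonneg (by positivity)]
  have hs : √|u| ≤ (1 + |u|) ^ (1 / 2 : ℝ) := by
    rw [← Real.sqrt_eq_rpow]
    exact Real.sqrt_le_sqrt (by linarith)
  calc (Real.sin u / u) ^ 2 * √|u|
      ≤ (4 * ((1 + |u|) ^ 2)⁻¹) * (1 + |u|) ^ (1 / 2 : ℝ) :=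
        mul_le_mul (fk_bound u) hs (by positivity) (by positivity)
    _ = 4 * (1 + ‖u‖) ^ (-(3 / 2) : ℝ) := by
        have hp : 0 < 1 + |u| := by positivity
        rw [Real.norm_eq_abs, mul_assoc, ← Real.rpow_natCast, ← Real.rpow_neg hp.le,
          ← Real.rpow_add hp]
        norm_num

/-- The triangle function. -/
noncomputable def fkTri (x : ℝ) : ℂ := ((max 0 (1 - |x|) : ℝ) : ℂ)

lemma fkTri_cont : Continuous fkTri := by
  unfold fkTri; fun_prop

lemma fkTri_supp : Function.support fkTri ⊆ Set.Ioc (-1) 1 := by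
  intro x hx
  by_contra h
  apply hx
  have : 1 ≤ |x| := by
    by_contra h'
    push Not at h'
    rw [abs_lt] at h'
    exact h ⟨h'.1, h'.2.le⟩
  simp [fkTri, this]

lemma fkTri_integrable : Integrable fkTri := by
  refine fkTri_cont.integrable_of_hasCompactSupport ?_
  refine HasCompactSupport.intro (isCompact_Icc (a := (-1 : ℝ)) (b := 1)) fun x hx => ?_
  by_contra h
  exact hx (Set.Ioc_subset_Icc_self (fkTri_supp h))

lemma fk_int_right (c : ℂ) (hc : c ≠ 0) :
    ∫ x in (0 : ℝ)..1, (1 - (x : ℂ)) * Complex.exp (c * x)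
      = Complex.exp c / c ^ 2 - 1 / c - 1 / c ^ 2 := by
  have hd : ∀ x ∈ Set.uIcc (0 : ℝ) 1,
      HasDerivAt (fun x : ℝ => ((1 - (x : ℂ)) / c + 1 / c ^ 2) * Complex.exp (c * x))
        ((1 - (x : ℂ)) * Complex.exp (c * x)) x := by
    intro x _
    have h1 : HasDerivAt (fun y : ℝ => (y : ℂ)) 1 x := Complex.ofRealCLM.hasDerivAt
    have h2 := (((h1.const_sub 1).div_const c).add_const (1 / c ^ 2)).mul (h1.const_mul c).cexp
    refine h2.congr_deriv ?_
    field_simp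
    ring
  rw [intervalIntegral.integral_eq_sub_of_hasDerivAt hd
    (Continuous.intervalIntegrable (by fun_prop) _ _)]
  simp
  ring

lemma fk_int_left (c : ℂ) (hc : c ≠ 0) :
    ∫ x in (-1 : ℝ)..0, (1 + (x : ℂ)) * Complex.exp (c * x)
      = Complex.exp (-c) / c ^ 2 + 1 / c - 1 / c ^ 2 := by
  have h := fk_int_right (-c) (neg_ne_zero.2 hc)
  have h2 := intervalIntegral.integral_comp_neg (a := 0) (b := 1)
    (fun x : ℝ => (1 + (x : ℂ)) * Complex.exp (c * x))
  rw [neg_zero] at h2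
  rw [← h2]
  have e : (fun x : ℝ => (1 + ((-x : ℝ) : ℂ)) * Complex.exp (c * ((-x : ℝ) : ℂ)))
      = fun x : ℝ => (1 - (x : ℂ)) * Complex.exp (-c * x) := by
    funext x
    push_cast
    ring_nf
  rw [e, h]
  field_simp
  ring

lemma fkTri_fourier (w : ℝ) (hw : w ≠ 0) :
    FourierTransform.fourier fkTri w = (((Real.sin (π * w) / (π * w)) ^ 2 : ℝ) : ℂ) := by
  rw [Real.fourier_real_eq_integral_exp_smul]
  set c : ℂ := -2 * π * w * Complex.I with hc
  have hw' : (w : ℂ) ≠ 0 := by exact_mod_cast hw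
  have hpi : (π : ℂ) ≠ 0 := by exact_mod_cast Real.pi_ne_zero
  have hc0 : c ≠ 0 := by
    rw [hc]; simp [hw, Real.pi_ne_zero]
  have e1 : (fun v : ℝ => Complex.exp (((-2 * π * v * w : ℝ) : ℂ) * Complex.I) • fkTri v)
      = fun v : ℝ => fkTri v * Complex.exp (c * v) := by
    funext v
    rw [smul_eq_mul, mul_comm, hc]
    push_cast
    ring_nf
  have hcont : Continuous fun v : ℝ => fkTri v * Complex.exp (c * v) :=
    fkTri_cont.mul (by fun_prop)
  rw [e1, ← intervalIntegral.integral_eq_integral_of_support_subset (a := -1) (b := 1)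
    ((Function.support_mul_subset_left _ _).trans fkTri_supp),
    ← intervalIntegral.integral_add_adjacent_intervals (b := 0)
      (hcont.intervalIntegrable _ _) (hcont.intervalIntegrable _ _)]
  have hL : ∫ v in (-1 : ℝ)..0, fkTri v * Complex.exp (c * v)
      = ∫ x in (-1 : ℝ)..0, (1 + (x : ℂ)) * Complex.exp (c * x) := by
    refine intervalIntegral.integral_congr fun x hx => ?_
    rw [Set.uIcc_of_le (by norm_num)] at hx
    have : max 0 (1 - |x|) = 1 + x := by
      rw [abs_of_nonpos hx.2, max_eq_right (by linarith [hx.1])]; ring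
    simp only [fkTri, this]
    push_cast; rfl
  have hR : ∫ v in (0 : ℝ)..1, fkTri v * Complex.exp (c * v)
      = ∫ x in (0 : ℝ)..1, (1 - (x : ℂ)) * Complex.exp (c * x) := by
    refine intervalIntegral.integral_congr fun x hx => ?_
    rw [Set.uIcc_of_le (by norm_num)] at hx
    have : max 0 (1 - |x|) = 1 - x := by
      rw [abs_of_nonneg hx.1, max_eq_right (by linarith [hx.2])]
    simp only [fkTri, this]
    push_cast; rfl
  rw [hL, hR, fk_int_left c hc0, fk_int_right c hc0]
  have hsum : Complex.exp c + Complex.exp (-c) = 2 - 4 * Complex.sin (π * w) ^ 2 := by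
    have h1 : 2 * Complex.cos (2 * (π * w)) = Complex.exp c + Complex.exp (-c) := by
      rw [Complex.two_cos, hc, add_comm]
      ring_nf
    rw [← h1, Complex.cos_two_mul, Complex.cos_sq']
    ring
  have hc2 : c ^ 2 = -4 * (π * w) ^ 2 := by
    rw [hc, mul_pow, Complex.I_sq]; ring
  have : Complex.exp (-c) / c ^ 2 + 1 / c - 1 / c ^ 2 + (Complex.exp c / c ^ 2 - 1 / c - 1 / c ^ 2)
      = ((Complex.exp c + Complex.exp (-c)) - 2) / c ^ 2 := by ring
  rw [this, hsum, hc2]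
  push_cast
  field_simp
  ring

lemma fk_integral : ∫ u : ℝ, (Real.sin u / u) ^ 2 = π := by
  have hae : FourierTransform.fourier fkTri
      =ᵐ[volume] fun w : ℝ => (((Real.sin (π * w) / (π * w)) ^ 2 : ℝ) : ℂ) := by
    filter_upwards [compl_mem_ae_iff.2 (measure_singleton (0 : ℝ))] with w hw
    exact fkTri_fourier w hw
  have hi : Integrable (fun w : ℝ => (((Real.sin (π * w) / (π * w)) ^ 2 : ℝ) : ℂ)) :=
    (fk_integrable.comp_mul_left' Real.pi_ne_zero).ofReal
  have hinv := fkTri_integrable.fourierInv_fourier_eq (hi.congr hae.symm)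
    (fkTri_cont.continuousAt (x := 0))
  rw [Real.fourierInv_eq'] at hinv
  simp only [inner_zero_right, mul_zero, Complex.ofReal_zero, zero_mul, Complex.exp_zero,
    one_smul] at hinv
  rw [integral_congr_ae hae, integral_complex_ofReal,
    Measure.integral_comp_mul_left (fun u : ℝ => (Real.sin u / u) ^ 2) π] at hinv
  have h0 : fkTri 0 = ((1 : ℝ) : ℂ) := by simp [fkTri]
  rw [h0] at hinv
  have h1 := Complex.ofReal_injective hinv
  rw [abs_of_pos (by positivity), smul_eq_mul] at h1
  field_simp at h1
  simpa only [div_pow] using h1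

lemma fk_diff (f f' : ℝ → ℂ) (Mf Mf' : ℝ) (hd : ∀ x : ℝ, HasDerivAt f (f' x) x)
    (hf : ∀ x : ℝ, ‖f x‖ ≤ Mf) (hf' : ∀ x : ℝ, ‖f' x‖ ≤ Mf') (y : ℝ) :
    ‖f y - f 0‖ ≤ (Mf + Mf') * √(2 * |y|) := by
  have hM : 0 ≤ Mf := (norm_nonneg _).trans (hf 0)
  have hM' : 0 ≤ Mf' := (norm_nonneg _).trans (hf' 0)
  have h1 : ‖f y - f 0‖ ≤ Mf' * ‖y - 0‖ :=
    Convex.norm_image_sub_le_of_norm_hasDerivWithin_le (s := Set.univ)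
      (fun x _ => (hd x).hasDerivWithinAt) (fun x _ => hf' x) convex_univ trivial trivial
  rw [sub_zero, Real.norm_eq_abs] at h1
  have h2 : ‖f y - f 0‖ ≤ 2 * Mf := by
    have := norm_sub_le (f y) (f 0)
    linarith [hf y, hf 0]
  have hs := Real.sqrt_nonneg (2 * |y|)
  have ha := abs_nonneg y
  rcases le_total |y| 2 with h | h
  · have : |y| ≤ √(2 * |y|) := Real.le_sqrt_of_sq_le (by nlinarith)
    nlinarith
  · have : 2 ≤ √(2 * |y|) := Real.le_sqrt_of_sq_le (by nlinarith)
    nlinarith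


/-- **Quantitative delta-function approximation by the Fejér-type kernel.**
There is an absolute constant `C` such that for every bounded `C¹` function
`f : ℝ → ℂ` with bounded derivative and every `t ≥ 1`,
`| t ∫ (sin(tx/2)/(tx/2))² f(x) dx − 2π f(0) | ≤ C (‖f‖_∞ + ‖f'‖_∞) t^{-1/2}`. -/
theorem fejer_kernel_delta_approx :
    ∃ C : ℝ, 0 < C ∧ ∀ (f f' : ℝ → ℂ) (Mf Mf' : ℝ),
      (∀ x : ℝ, HasDerivAt f (f' x) x) → Continuous f' →
      (∀ x : ℝ, ‖f x‖ ≤ Mf) → (∀ x : ℝ, ‖f' x‖ ≤ Mf') →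
      ∀ t : ℝ, 1 ≤ t →
        ‖(t : ℂ) * (∫ x : ℝ, ((Real.sin (t * x / 2) / (t * x / 2)) ^ 2 : ℝ) • f x)
            - ((2 * Real.pi : ℝ) : ℂ) * f 0‖
          ≤ C * (Mf + Mf') * t ^ (-(1 : ℝ) / 2) := by

  set J : ℝ := ∫ u : ℝ, (Real.sin u / u) ^ 2 * √|u| with hJ
  have hJ0 : 0 ≤ J := integral_nonneg fun u => by positivity
  refine ⟨4 * J + 1, by positivity, ?_⟩
  intro f f' Mf Mf' hd _ hf hf' t ht
  have hM : 0 ≤ Mf := (norm_nonneg _).trans (hf 0)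
  have hM' : 0 ≤ Mf' := (norm_nonneg _).trans (hf' 0)
  have ht0 : 0 < t := by linarith
  have hfc : Continuous f := continuous_iff_continuousAt.2 fun x => (hd x).continuousAt
  set g : ℝ → ℂ := fun u => ((Real.sin u / u) ^ 2 : ℝ) • f (2 / t * u) with hg
  have hsub : (∫ x : ℝ, ((Real.sin (t * x / 2) / (t * x / 2)) ^ 2 : ℝ) • f x)
      = |(t / 2)⁻¹| • ∫ u, g u := by
    rw [← Measure.integral_comp_mul_left g (t / 2)]
    congr 1
    funext x
    have e1 : t / 2 * x = t * x / 2 := by ring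
    have e2 : 2 / t * (t * x / 2) = x := by field_simp
    simp only [hg, e1, e2]
  have hgi : Integrable g := by
    refine (fk_integrable.mul_const Mf).mono' ?_ (Filter.Eventually.of_forall fun u => ?_)
    · exact fk_meas.aestronglyMeasurable.smul
        (hfc.comp (continuous_const.mul continuous_id)).aestronglyMeasurable
    · rw [hg]
      simp only [norm_smul]
      rw [Real.norm_of_nonneg (by positivity)]
      exact mul_le_mul_of_nonneg_left (hf _) (by positivity)
  have hmain : (t : ℂ) * (∫ x : ℝ, ((Real.sin (t * x / 2) / (t * x / 2)) ^ 2 : ℝ) • f x)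
            - ((2 * Real.pi : ℝ) : ℂ) * f 0
      = 2 * ∫ u : ℝ, ((Real.sin u / u) ^ 2 : ℝ) • (f (2 / t * u) - f 0) := by
    have h1 : ∫ u : ℝ, ((Real.sin u / u) ^ 2 : ℝ) • (f (2 / t * u) - f 0)
        = (∫ u, g u) - (π : ℂ) * f 0 := by
      simp only [smul_sub]
      rw [integral_sub hgi (fk_integrable.smul_const (f 0)), integral_smul_const, fk_integral,
        Complex.real_smul]
    have htc : (t : ℂ) ≠ 0 := by exact_mod_cast ht0.ne'
    rw [h1, hsub, abs_of_pos (by positivity), Complex.real_smul]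
    push_cast
    field_simp
  have ht' : t ^ (-(1 : ℝ) / 2) = (√t)⁻¹ := by
    rw [neg_div, Real.rpow_neg ht0.le, Real.sqrt_eq_rpow]
  have hb : ‖∫ u : ℝ, ((Real.sin u / u) ^ 2 : ℝ) • (f (2 / t * u) - f 0)‖
      ≤ ∫ u : ℝ, ((Mf + Mf') * (2 * (√t)⁻¹)) * ((Real.sin u / u) ^ 2 * √|u|) := by
    refine norm_integral_le_of_norm_le (fk_integrable_sqrt.const_mul _)
      (Filter.Eventually.of_forall fun u => ?_)
    rw [norm_smul, Real.norm_of_nonneg (by positivity)]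
    have h := fk_diff f f' Mf Mf' hd hf hf' (2 / t * u)
    have e : √(2 * |2 / t * u|) = 2 * (√t)⁻¹ * √|u| := by
      rw [abs_mul, abs_of_pos (by positivity : 0 < 2 / t)]
      have : 2 * (2 / t * |u|) = 2 ^ 2 * (t⁻¹ * |u|) := by ring
      rw [this, Real.sqrt_mul (by positivity), Real.sqrt_sq (by norm_num),
        Real.sqrt_mul (by positivity), Real.sqrt_inv, mul_assoc]
    rw [e] at h
    calc (Real.sin u / u) ^ 2 * ‖f (2 / t * u) - f 0‖
        ≤ (Real.sin u / u) ^ 2 * ((Mf + Mf') * (2 * (√t)⁻¹ * √|u|)) :=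
          mul_le_mul_of_nonneg_left h (by positivity)
      _ = _ := by ring
  rw [integral_const_mul, ← hJ] at hb
  rw [hmain, ht', norm_mul, Complex.norm_ofNat]
  have hp : 0 ≤ (Mf + Mf') * (√t)⁻¹ := by positivity
  nlinarith
end

section
/- Let x̃, y ∈ ℝ with sin(πx̃) ≠ 0 and sin(π(y−x̃)) ≠ 0. Then cos(πy) − cos(π(y−2x̃)) ≠ 0, and | sin(πy) sin(π(y−2x̃)) / (cos(πy) − cos(π(y−2x̃))) | = | sin(πy/2) cos(π(y/2 − x̃)) | · | 1/sin(πx̃) − 1/sin(π(y−x̃)) | ≤ 1/|sin(πx̃)| + 1/|sin(π(y−x̃))|. -/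
open Real

/-- **Trigonometric factorization (equation (4.18)).** The Jacobian factor appearing in
the proof of the three-vector counting estimate: under the nonvanishing hypotheses, the
denominator is nonzero and the quotient factors and is bounded by
`1/|sin(πx̃)| + 1/|sin(π(y−x̃))|`. -/
theorem jacobian_factorization_three_vector (xt y : ℝ)
    (hx : Real.sin (π * xt) ≠ 0) (hy : Real.sin (π * (y - xt)) ≠ 0) :
    Real.cos (π * y) - Real.cos (π * (y - 2 * xt)) ≠ 0 ∧
    |Real.sin (π * y) * Real.sin (π * (y - 2 * xt))
        / (Real.cos (π * y) - Real.cos (π * (y - 2 * xt)))|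
      = |Real.sin (π * y / 2) * Real.cos (π * (y / 2 - xt))|
        * |1 / Real.sin (π * xt) - 1 / Real.sin (π * (y - xt))| ∧
    |Real.sin (π * y) * Real.sin (π * (y - 2 * xt))
        / (Real.cos (π * y) - Real.cos (π * (y - 2 * xt)))|
      ≤ 1 / |Real.sin (π * xt)| + 1 / |Real.sin (π * (y - xt))| := by
  obtain ⟨a, ha⟩ : ∃ a, a = π * y / 2 := ⟨_, rfl⟩
  obtain ⟨b, hb⟩ : ∃ b, b = π * (y / 2 - xt) := ⟨_, rfl⟩
  have e1 : π * y = 2 * a := by rw [ha]; ring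
  have e2 : π * (y - 2 * xt) = 2 * b := by rw [hb]; ring
  have e3 : π * xt = a - b := by rw [ha, hb]; ring
  have e4 : π * (y - xt) = a + b := by rw [ha, hb]; ring
  rw [e3] at hx
  rw [e4] at hy
  rw [← ha, ← hb, e1, e2, e3, e4]
  have hden : Real.cos (2 * a) - Real.cos (2 * b)
      = -2 * Real.sin (a + b) * Real.sin (a - b) := by
    rw [Real.cos_sub_cos]
    congr 2
    · congr 2; ring
    · ring
  have hdiff : Real.sin (a + b) - Real.sin (a - b) = 2 * Real.cos a * Real.sin b := by
    rw [Real.sin_add, Real.sin_sub]; ring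
  have hkey : Real.sin (2 * a) * Real.sin (2 * b) / (Real.cos (2 * a) - Real.cos (2 * b))
      = -((Real.sin a * Real.cos b) * (1 / Real.sin (a - b) - 1 / Real.sin (a + b))) := by
    rw [hden, div_sub_div _ _ hx hy, one_mul, mul_one, hdiff, Real.sin_two_mul,
      Real.sin_two_mul]
    field_simp
  have heq : |Real.sin (2 * a) * Real.sin (2 * b) / (Real.cos (2 * a) - Real.cos (2 * b))|
      = |Real.sin a * Real.cos b| * |1 / Real.sin (a - b) - 1 / Real.sin (a + b)| := by
    rw [hkey, abs_neg, abs_mul]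
  refine ⟨?_, heq, ?_⟩
  · rw [hden]
    exact mul_ne_zero (mul_ne_zero (by norm_num) hy) hx
  · rw [heq]
    have h1 : |Real.sin a * Real.cos b| ≤ 1 := by
      rw [abs_mul]
      exact mul_le_one₀ (Real.abs_sin_le_one a) (abs_nonneg _) (Real.abs_cos_le_one b)
    calc _ ≤ 1 * |1 / Real.sin (a - b) - 1 / Real.sin (a + b)| :=
          mul_le_mul_of_nonneg_right h1 (abs_nonneg _)
      _ ≤ |1 / Real.sin (a - b)| + |1 / Real.sin (a + b)| := by
          rw [one_mul]; exact abs_sub _ _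
      _ = _ := by rw [abs_div, abs_div, abs_one]
end

section
/- Let x, k ∈ ℝ with sin(πk/2) ≠ 0 and sin(π(x − k/2)) ≠ 0. Then | sin(πx) sin(π(k−x)) / (sin(πk/2) sin(π(x − k/2))) | = 2 | sin(πx/2) cos(π(k−x)/2) | · | 1/sin(πk/2) − 1/sin(π(x − k/2)) | ≤ 2 ( 1/|sin(πk/2)| + 1/|sin(π(x − k/2))| ). -/
open Real

/-- **Trigonometric factorization in the two-vector counting estimate (Proposition 4.3).**
Under the nonvanishing hypotheses, the Jacobian factor arising from the substitution
`dx = dΩ₂/Ω₂'(x)` factors and is bounded by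
`2(1/|sin(πk/2)| + 1/|sin(π(x−k/2))|)`. -/
theorem jacobian_factorization_two_vector (x k : ℝ)
    (hk : Real.sin (π * k / 2) ≠ 0) (hx : Real.sin (π * (x - k / 2)) ≠ 0) :
    |Real.sin (π * x) * Real.sin (π * (k - x))
        / (Real.sin (π * k / 2) * Real.sin (π * (x - k / 2)))|
      = 2 * |Real.sin (π * x / 2) * Real.cos (π * (k - x) / 2)|
        * |1 / Real.sin (π * k / 2) - 1 / Real.sin (π * (x - k / 2))| ∧
    |Real.sin (π * x) * Real.sin (π * (k - x))
        / (Real.sin (π * k / 2) * Real.sin (π * (x - k / 2)))|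
      ≤ 2 * (1 / |Real.sin (π * k / 2)| + 1 / |Real.sin (π * (x - k / 2))|) := by
  have hS : Real.sin (π * k / 2) = Real.sin (π * x / 2) * Real.cos (π * (k - x) / 2)
      + Real.cos (π * x / 2) * Real.sin (π * (k - x) / 2) := by
    rw [← Real.sin_add]; congr 1; ring
  have hD : Real.sin (π * (x - k / 2)) = Real.sin (π * x / 2) * Real.cos (π * (k - x) / 2)
      - Real.cos (π * x / 2) * Real.sin (π * (k - x) / 2) := by
    rw [← Real.sin_sub]; congr 1; ring
  have h1 : Real.sin (π * x) = 2 * Real.sin (π * x / 2) * Real.cos (π * x / 2) := by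
    rw [← Real.sin_two_mul]; congr 1; ring
  have h2 : Real.sin (π * (k - x))
      = 2 * Real.sin (π * (k - x) / 2) * Real.cos (π * (k - x) / 2) := by
    rw [← Real.sin_two_mul]; congr 1; ring
  have ha : |Real.sin (π * x / 2) * Real.cos (π * (k - x) / 2)| ≤ 1 := by
    rw [abs_mul]
    exact mul_le_one₀ (Real.abs_sin_le_one _) (abs_nonneg _) (Real.abs_cos_le_one _)
  rw [h1, h2]
  generalize Real.sin (π * k / 2) = S at *
  generalize Real.sin (π * (x - k / 2)) = D at *
  generalize Real.sin (π * x / 2) = sa at *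
  generalize Real.cos (π * x / 2) = ca at *
  generalize Real.sin (π * (k - x) / 2) = sb at *
  generalize Real.cos (π * (k - x) / 2) = cb at *
  have key : |2 * sa * ca * (2 * sb * cb) / (S * D)| = 2 * |sa * cb| * |1 / S - 1 / D| := by
    have h : 2 * sa * ca * (2 * sb * cb) / (S * D) = -(2 * (sa * cb) * (1 / S - 1 / D)) := by
      have e : 1 / S - 1 / D = (D - S) / (S * D) := by field_simp
      have e2 : D - S = -(2 * (ca * sb)) := by rw [hS, hD]; ring
      rw [e, e2]; ring
    rw [h, abs_neg, abs_mul, abs_mul, abs_two]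
  refine ⟨key, ?_⟩
  rw [key]
  have t : |1 / S - 1 / D| ≤ 1 / |S| + 1 / |D| := by
    have := abs_sub (1 / S) (1 / D)
    simpa [abs_div] using this
  calc 2 * |sa * cb| * |1 / S - 1 / D| ≤ 2 * 1 * (1 / |S| + 1 / |D|) := by gcongr
    _ = _ := by ring
end
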